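/- Let h=3 and let 0≤n≤N be integers. For 0≤j≤n define ξ_{n−j,j}∈V_{3,N} by ξ_{n−j,j}(x_1,x_2,x_3) = q^{−j x_1}·Q_{n−j}(x_1; α_1, α_2α_3 q^{2j+1}, N−j | q)·Q_j(x_2; α_2, α_3, x_2+x_3 | q) when x_2+x_3≥j, and 0 otherwise; for 0≤i≤n define θ_{n−i,i}∈V_{3,N} by θ_{n−i,i}(x_1,x_2,x_3) = Q_{n−i}(x_1+x_2−i; α_1α_2 q^{2i+1}, α_3, N−i | q)·Q_i(x_1; α_1, α_2, x_1+x_2 | q) when x_1+x_2≥i, and 0 otherwise. Then for every 0≤j≤n: ξ_{n−j,j} = ∑_{i=0}^{n} r_i(j; α_2, α_1, α_2α_3 q^{n+1}, n | q) · θ_{n−i,i}. -/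

import Mathlib

open Finset

noncomputable section

/-- q-shifted factorial `(a;q)_m`. -/
def qPoch (q a : ℝ) (m : ℕ) : ℝ := ∏ k ∈ Finset.range m, (1 - a * q ^ k)

/-- Two-variable raising operator `R_M : V_{2,M} → V_{2,M+1}` (on functions of `x = x₁`). -/
def R2 (q : ℝ) (M : ℕ) (g : ℕ → ℂ) : ℕ → ℂ := fun x =>
  (q : ℂ) ^ (-(M : ℤ) - 1) * (1 - (q : ℂ) ^ x) * g (x - 1) +
    (q : ℂ) ^ ((x : ℤ) - M - 1) * (1 - (q : ℂ) ^ ((M : ℤ) + 1 - x)) * g x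

/-- `R2Iter q n k g = R_{n+k-1} ⋯ R_{n+1} R_n g`. -/
def R2Iter (q : ℝ) (n : ℕ) : ℕ → (ℕ → ℂ) → (ℕ → ℂ)
  | 0, g => g
  | k + 1, g => R2 q (n + k) (R2Iter q n k g)

/-- The function `φ_n(x) = q^{-n²/2}(q;q)_n (abq^{n+1})^x (b⁻¹q^{-n};q)_x / (aq;q)_x`. -/
def phiH (q a b : ℝ) (n : ℕ) : ℕ → ℂ := fun x =>
  ((q ^ (-((n : ℝ) ^ 2) / 2) * qPoch q q n * (a * b * q ^ (n + 1)) ^ x *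
      qPoch q (b⁻¹ * q ^ (-(n : ℤ))) x / qPoch q (a * q) x : ℝ) : ℂ)

/-- The one-dimensional q-Hahn polynomial `Q_n(x; a, b, N | q)`. -/
def qHahnQ (q a b : ℝ) (n N : ℕ) : ℕ → ℂ := fun x =>
  ((q : ℂ) ^ ((N - n) * (N - n + 1) / 2) / ((qPoch q q (N - n) : ℝ) : ℂ)) *
    R2Iter q n (N - n) (phiH q a b n) x

/-- The q-Racah polynomial `r_n(x; a, b, d, N | q)`. -/
def qRacah (q a b d : ℝ) (N n x : ℕ) : ℝ :=
  q ^ (-((n * (N - n) : ℕ) : ℤ)) *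
    (qPoch q (b * d * q) n * qPoch q (q ^ (N - n + 1)) n /
      (qPoch q (a * b * q ^ (n + 1)) n * qPoch q q n)) *
    ∑ k ∈ Finset.range (n + 1),
      qPoch q (q ^ (-(n : ℤ))) k * qPoch q (d * q ^ ((x : ℤ) - N)) k *
        qPoch q (q ^ (-(x : ℤ))) k * qPoch q (a * b * q ^ (n + 1)) k /
        (qPoch q (a * q) k * qPoch q (b * d * q) k * qPoch q (q ^ (-(N : ℤ))) k *
          qPoch q q k) *
        q ^ k

/-- Rescaled q-Hahn polynomial on `{0, …, n + m}`, obtained by raising `m` times. -/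
def hahnAux (q a b : ℝ) (n : ℕ) : ℕ → ℕ → ℝ
  | 0, x => qPoch q q n * (a * b * q ^ (n + 1)) ^ x *
      qPoch q (b⁻¹ * q ^ (-(n : ℤ))) x / qPoch q (a * q) x
  | m + 1, x => ((1 - q ^ x) * hahnAux q a b n m (x - 1) +
      (q ^ x - q ^ (n + m + 1)) * hahnAux q a b n m x) / (1 - q ^ (m + 1))

/-- Rescaled q-Hahn polynomial of degree `n` on `{0, …, N}`, zero when `N < n`. -/
def hahn (q a b : ℝ) (n N x : ℕ) : ℝ :=
  if n ≤ N then hahnAux q a b n (N - n) x else 0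

lemma qPoch_zero (q a : ℝ) : qPoch q a 0 = 1 := by simp [qPoch]

lemma qPoch_succ (q a : ℝ) (m : ℕ) :
    qPoch q a (m + 1) = qPoch q a m * (1 - a * q ^ m) := by
  simp [qPoch, Finset.prod_range_succ]

lemma qPoch_succ' (q a : ℝ) (m : ℕ) :
    qPoch q a (m + 1) = (1 - a) * qPoch q (a * q) m := by
  simp only [qPoch, Finset.prod_range_succ']
  simp only [pow_zero, mul_one, mul_comm (1 - a)]
  congr 1
  refine Finset.prod_congr rfl fun k _ => ?_
  ring

lemma qPoch_ne_zero (q a : ℝ) (m : ℕ) (h : ∀ k < m, 1 - a * q ^ k ≠ 0) : qPoch q a m ≠ 0 :=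
  Finset.prod_ne_zero_iff.2 fun k hk => h k (Finset.mem_range.1 hk)

lemma one_sub_pow_succ_ne_zero {q : ℝ} (hq0 : 0 < q) (hq1 : q < 1) (m : ℕ) :
    1 - q ^ (m + 1) ≠ 0 :=
  (sub_pos.2 (pow_lt_one₀ hq0.le hq1 m.succ_ne_zero)).ne'

lemma qPoch_self_ne_zero {q : ℝ} (hq0 : 0 < q) (hq1 : q < 1) (m : ℕ) : qPoch q q m ≠ 0 :=
  qPoch_ne_zero q q m fun k _ => by
    have := one_sub_pow_succ_ne_zero hq0 hq1 k
    rwa [pow_succ'] at this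

lemma one_sub_mul_pow_pos {q a : ℝ} (hq0 : 0 < q) (hq1 : q < 1) (k : ℕ)
    (h : a * q < 1) (ha : 0 < a) : 0 < 1 - a * q ^ (k + 1) := by
  have h1 : q ^ k ≤ 1 := pow_le_one₀ hq0.le hq1.le
  have : a * q ^ (k + 1) = a * q * q ^ k := by ring
  have : a * q * q ^ k ≤ a * q * 1 := mul_le_mul_of_nonneg_left h1 (by positivity)
  linarith

lemma hahnAux_succ {q : ℝ} (hq0 : 0 < q) (hq1 : q < 1) (a b : ℝ) (n m x : ℕ) :
    (1 - q ^ (m + 1)) * hahnAux q a b n (m + 1) x =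
      (1 - q ^ x) * hahnAux q a b n m (x - 1) +
        (q ^ x - q ^ (n + m + 1)) * hahnAux q a b n m x := by
  rw [hahnAux, mul_div_cancel₀ _ (one_sub_pow_succ_ne_zero hq0 hq1 m)]

/-- The raising relation for the rescaled q-Hahn polynomials. -/
lemma hahn_raise {q : ℝ} (hq0 : 0 < q) (hq1 : q < 1) (a b : ℝ) (n N x : ℕ) :
    (q ^ n - q ^ (N + 1)) * hahn q a b n (N + 1) x =
      q ^ n * ((1 - q ^ x) * hahn q a b n N (x - 1) +
        (q ^ x - q ^ (N + 1)) * hahn q a b n N x) := by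
  rcases lt_trichotomy n (N + 1) with h | h | h
  · obtain ⟨m, rfl⟩ := Nat.exists_eq_add_of_le (Nat.lt_succ_iff.1 h)
    have e1 : n + m + 1 - n = m + 1 := by omega
    have e2 : n + m - n = m := by omega
    simp only [hahn, e1, e2, if_pos (show n ≤ n + m by omega),
      if_pos (show n ≤ n + m + 1 by omega)]
    rw [← hahnAux_succ hq0 hq1]
    ring
  · subst h
    simp [hahn]
  · simp [hahn, show ¬ n ≤ N + 1 by omega, show ¬ n ≤ N by omega]

lemma hahnAux_zero_succ {q a b : ℝ} (hq0 : 0 < q) (hb : b ≠ 0)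
    (ha : ∀ k : ℕ, 1 - a * q ^ (k + 1) ≠ 0) (n x : ℕ) :
    (1 - a * q ^ (x + 1)) * hahnAux q a b n 0 (x + 1) +
      a * q * (q ^ x - b * q ^ n) * hahnAux q a b n 0 x = 0 := by
  have h1 : qPoch q (a * q) x ≠ 0 := qPoch_ne_zero _ _ _ fun k _ => by
    have := ha k
    rwa [pow_succ', ← mul_assoc] at this
  have h2 := ha x
  have h3 : (1 - a * q * q ^ x) ≠ 0 := by rwa [pow_succ', ← mul_assoc] at h2
  have hq := hq0.ne'
  simp only [hahnAux, qPoch_succ, zpow_neg, zpow_natCast]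
  rw [show 1 - a * q ^ (x + 1) = 1 - a * q * q ^ x by ring]
  generalize 1 - a * q * q ^ x = D at h3
  generalize qPoch q (a * q) x = P at h1
  generalize qPoch q (b⁻¹ * (q ^ n)⁻¹) x = P'
  field_simp
  ring

lemma hahnAux_lower {q a b : ℝ} (hq0 : 0 < q) (hq1 : q < 1) (hb : b ≠ 0)
    (ha : ∀ k : ℕ, 1 - a * q ^ (k + 1) ≠ 0) (n m : ℕ) : ∀ x,
    (1 - a * q ^ (x + 1)) * hahnAux q a b n (m + 1) (x + 1) +
      a * q * (q ^ x - b * q ^ (n + m + 1)) * hahnAux q a b n (m + 1) x =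
      (1 - a * b * q ^ (2 * n + m + 2)) * hahnAux q a b n m x := by
  induction m with
  | zero =>
    intro x
    have hm := one_sub_pow_succ_ne_zero hq0 hq1 0
    apply mul_left_cancel₀ hm
    have r1 := hahnAux_succ hq0 hq1 a b n 0 x
    have r2 := hahnAux_succ hq0 hq1 a b n 0 (x + 1)
    have l1 := hahnAux_zero_succ hq0 hb ha n x
    rcases x with _ | x
    · simp only [Nat.zero_add, Nat.zero_sub, pow_zero] at *
      linear_combination (1 - a * q ^ 1) * r2 + a * q * (1 - b * q ^ (n + 1)) * r1
        + q * (1 - q ^ n) * l1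
    · have l2 := hahnAux_zero_succ hq0 hb ha n x
      simp only [Nat.add_sub_cancel] at *
      linear_combination (1 - a * q ^ (x + 2)) * r2 +
        a * q * (q ^ (x + 1) - b * q ^ (n + 1)) * r1
        + q * (q ^ (x + 1) - q ^ n) * l1 + q * (1 - q ^ (x + 1)) * l2
  | succ m ih =>
    intro x
    have hm := one_sub_pow_succ_ne_zero hq0 hq1 (m + 1)
    apply mul_left_cancel₀ hm
    have r1 := hahnAux_succ hq0 hq1 a b n (m + 1) x
    have r2 := hahnAux_succ hq0 hq1 a b n (m + 1) (x + 1)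
    have r3 := hahnAux_succ hq0 hq1 a b n m x
    have l1 := ih x
    rcases x with _ | x
    · simp only [Nat.zero_add, Nat.zero_sub, pow_zero] at *
      linear_combination (1 - a * q ^ 1) * r2 + a * q * (1 - b * q ^ (n + m + 2)) * r1
        + q * (1 - q ^ (n + m + 1)) * l1 - q * (1 - a * b * q ^ (2 * n + m + 2)) * r3
    · have l2 := ih x
      simp only [Nat.add_sub_cancel] at *
      linear_combination (1 - a * q ^ (x + 2)) * r2 +
        a * q * (q ^ (x + 1) - b * q ^ (n + m + 2)) * r1
        + q * (q ^ (x + 1) - q ^ (n + m + 1)) * l1 + q * (1 - q ^ (x + 1)) * l2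
        - q * (1 - a * b * q ^ (2 * n + m + 2)) * r3

/-- The lowering relation for the rescaled q-Hahn polynomials. -/
lemma hahn_lower {q a b : ℝ} (hq0 : 0 < q) (hq1 : q < 1) (hb : b ≠ 0)
    (ha : ∀ k : ℕ, 1 - a * q ^ (k + 1) ≠ 0) (n N x : ℕ) :
    (1 - a * q ^ (x + 1)) * hahn q a b n (N + 1) (x + 1) +
      a * q * (q ^ x - b * q ^ (N + 1)) * hahn q a b n (N + 1) x =
      (1 - a * b * q ^ (n + N + 2)) * hahn q a b n N x := by
  rcases lt_trichotomy n (N + 1) with h | h | h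
  · obtain ⟨m, rfl⟩ := Nat.exists_eq_add_of_le (Nat.lt_succ_iff.1 h)
    have e1 : n + m + 1 - n = m + 1 := by omega
    have e2 : n + m - n = m := by omega
    simp only [hahn, e1, e2, if_pos (show n ≤ n + m by omega),
      if_pos (show n ≤ n + m + 1 by omega)]
    rw [hahnAux_lower hq0 hq1 hb ha]
    ring
  · subst h
    simp only [hahn, le_refl, if_true, Nat.sub_self, show ¬ N + 1 ≤ N by omega, if_false]
    rw [hahnAux_zero_succ hq0 hb ha, mul_zero]
  · simp [hahn, show ¬ n ≤ N + 1 by omega, show ¬ n ≤ N by omega]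

lemma hahn_self_zero {q : ℝ} (a b : ℝ) (n : ℕ) : hahn q a b n n 0 = qPoch q q n := by
  simp [hahn, hahnAux, qPoch_zero]

lemma hahn_self_succ {q a b : ℝ} (hq0 : 0 < q) (hb : b ≠ 0)
    (ha : ∀ k : ℕ, 1 - a * q ^ (k + 1) ≠ 0) (n x : ℕ) :
    (1 - a * q ^ (x + 1)) * hahn q a b n n (x + 1) =
      - (a * q * (q ^ x - b * q ^ n) * hahn q a b n n x) := by
  have := hahnAux_zero_succ hq0 hb ha n x
  simp only [hahn, le_refl, if_true, Nat.sub_self]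
  linarith

/-- The two-step product decomposition in the first Jacobi-type order. -/
def xiAux (q a₁ a₂ a₃ : ℝ) (n j N x₁ x₂ x₃ : ℕ) : ℝ :=
  hahn q a₁ (a₂ * a₃ * q ^ (2 * j + 1)) (n - j) (N - j) x₁ * hahn q a₂ a₃ j (x₂ + x₃) x₂

/-- The two-step product decomposition in the second Jacobi-type order. -/
def thetaAux (q a₁ a₂ a₃ : ℝ) (n i N x₁ x₂ x₃ : ℕ) : ℝ :=
  q ^ (i * x₃) *
    (hahn q (a₁ * a₂ * q ^ (2 * i + 1)) a₃ (n - i) (N - i) (x₁ + x₂ - i) *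
      hahn q a₁ a₂ i (x₁ + x₂) x₁)

lemma hahn_of_lt {q a b : ℝ} {n N : ℕ} (h : N < n) (x : ℕ) : hahn q a b n N x = 0 := by
  simp [hahn, show ¬ n ≤ N by omega]

lemma hahn_raise_pred {q : ℝ} (hq0 : 0 < q) (hq1 : q < 1) (a b : ℝ) (n y z : ℕ) :
    q ^ n * ((1 - q ^ y) * hahn q a b n (y - 1 + z) (y - 1) +
        q ^ y * (1 - q ^ z) * hahn q a b n (y + (z - 1)) y) =
      (q ^ n - q ^ (y + z)) * hahn q a b n (y + z) y := by
  rcases y with _ | y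
  · rcases z with _ | z
    · rcases n with _ | n
      · simp
      · simp [hahn]
    · have := hahn_raise hq0 hq1 a b n z 0
      simp at *
      linear_combination -this
  · rcases z with _ | z
    · have := hahn_raise hq0 hq1 a b n y (y + 1)
      simp at *
      linear_combination -this
    · have := hahn_raise hq0 hq1 a b n (y + z + 1) (y + 1)
      simp only [Nat.add_sub_cancel] at *
      rw [show y + 1 + (z + 1) = y + z + 1 + 1 by ring, show y + (z + 1) = y + z + 1 by ring,
        show y + 1 + z = y + z + 1 by ring]
      linear_combination -this

lemma xiAux_raise {q : ℝ} (hq0 : 0 < q) (hq1 : q < 1) (a₁ a₂ a₃ : ℝ) {n j N x₁ x₂ x₃ : ℕ}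
    (hj : j ≤ n) (hn : n ≤ N) (hx : x₁ + x₂ + x₃ = N + 1) :
    (q ^ n - q ^ (N + 1)) * xiAux q a₁ a₂ a₃ n j (N + 1) x₁ x₂ x₃ =
      q ^ n * ((1 - q ^ x₁) * xiAux q a₁ a₂ a₃ n j N (x₁ - 1) x₂ x₃ +
        q ^ x₁ * (1 - q ^ x₂) * xiAux q a₁ a₂ a₃ n j N x₁ (x₂ - 1) x₃ +
        q ^ (x₁ + x₂) * (1 - q ^ x₃) * xiAux q a₁ a₂ a₃ n j N x₁ x₂ (x₃ - 1)) := by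
  have h1 := hahn_raise_pred hq0 hq1 a₂ a₃ j x₂ x₃
  unfold xiAux
  rcases lt_or_ge (x₂ + x₃) j with h | h
  · rw [hahn_of_lt h, hahn_of_lt (show x₂ - 1 + x₃ < j by omega),
      hahn_of_lt (show x₂ + (x₃ - 1) < j by omega)]
    simp
  · obtain ⟨t, ht⟩ := Nat.exists_eq_add_of_le h
    obtain ⟨k, rfl⟩ := Nat.exists_eq_add_of_le hj
    obtain ⟨m, rfl⟩ := Nat.exists_eq_add_of_le hn
    have h2 := hahn_raise hq0 hq1 a₁ (a₂ * a₃ * q ^ (2 * j + 1)) k (k + m) x₁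
    have e1 : j + k + m - j = k + m := by omega
    have e2 : j + k + m + 1 - j = k + m + 1 := by omega
    have e3 : j + k - j = k := by omega
    rw [e1, e2, e3]
    rw [ht] at h1 ⊢
    have e4 : q ^ (k + m + 1) = q ^ x₁ * q ^ t := by rw [← pow_add]; congr 1; omega
    rw [show j + k + m + 1 = j + (k + m + 1) by ring]
    simp only [pow_add q j] at *
    rw [e4] at h2 ⊢
    rw [pow_add q x₁]
    linear_combination q ^ j * hahn q a₂ a₃ j (j + t) x₂ * h2 -
      q ^ x₁ * q ^ k * hahn q a₁ (a₂ * a₃ * q ^ (2 * j + 1)) k (k + m) x₁ * h1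

lemma thetaAux_raise {q : ℝ} (hq0 : 0 < q) (hq1 : q < 1) (a₁ a₂ a₃ : ℝ) {n i N x₁ x₂ x₃ : ℕ}
    (hi : i ≤ n) (hn : n ≤ N) (hx : x₁ + x₂ + x₃ = N + 1) :
    (q ^ n - q ^ (N + 1)) * thetaAux q a₁ a₂ a₃ n i (N + 1) x₁ x₂ x₃ =
      q ^ n * ((1 - q ^ x₁) * thetaAux q a₁ a₂ a₃ n i N (x₁ - 1) x₂ x₃ +
        q ^ x₁ * (1 - q ^ x₂) * thetaAux q a₁ a₂ a₃ n i N x₁ (x₂ - 1) x₃ +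
        q ^ (x₁ + x₂) * (1 - q ^ x₃) * thetaAux q a₁ a₂ a₃ n i N x₁ x₂ (x₃ - 1)) := by
  have h1 := hahn_raise_pred hq0 hq1 a₁ a₂ i x₁ x₂
  unfold thetaAux
  rcases lt_or_ge (x₁ + x₂) i with h | h
  · rw [hahn_of_lt h, hahn_of_lt (show x₁ - 1 + x₂ < i by omega),
      hahn_of_lt (show x₁ + (x₂ - 1) < i by omega)]
    simp
  · obtain ⟨s, hs⟩ := Nat.exists_eq_add_of_le h
    obtain ⟨k, rfl⟩ := Nat.exists_eq_add_of_le hi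
    obtain ⟨m, rfl⟩ := Nat.exists_eq_add_of_le hn
    have h2 := hahn_raise hq0 hq1 (a₁ * a₂ * q ^ (2 * i + 1)) a₃ k (k + m) s
    have e1 : i + k + m - i = k + m := by omega
    have e2 : i + k + m + 1 - i = k + m + 1 := by omega
    have e3 : i + k - i = k := by omega
    have e5 : q ^ (i * x₃) * (1 - q ^ x₃) = q ^ i * q ^ (i * (x₃ - 1)) * (1 - q ^ x₃) := by
      rcases x₃ with _ | x₃
      · simp
      · simp only [Nat.add_sub_cancel]; ring
    have e6 : ∀ f : ℕ → ℝ, (1 - q ^ x₁) * f (x₁ - 1 + x₂ - i) = (1 - q ^ x₁) * f (s - 1) := by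
      intro f
      rcases x₁ with _ | x₁
      · simp
      · rw [show x₁ + 1 - 1 + x₂ - i = s - 1 by omega]
    have e7 : ∀ f : ℕ → ℝ, (1 - q ^ x₂) * f (x₁ + (x₂ - 1) - i) = (1 - q ^ x₂) * f (s - 1) := by
      intro f
      rcases x₂ with _ | x₂
      · simp
      · rw [show x₁ + (x₂ + 1 - 1) - i = s - 1 by omega]
    have e6' := e6 (hahn q (a₁ * a₂ * q ^ (2 * i + 1)) a₃ k (k + m))
    have e7' := e7 (hahn q (a₁ * a₂ * q ^ (2 * i + 1)) a₃ k (k + m))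
    rw [e1, e2, e3]
    rw [hs] at h1 ⊢
    have e8 : i + s - i = s := by omega
    rw [e8]
    have e4 : q ^ (k + m + 1) = q ^ s * q ^ x₃ := by rw [← pow_add]; congr 1; omega
    rw [show i + k + m + 1 = i + (k + m + 1) by ring]
    simp only [pow_add q i] at *
    rw [e4] at h2 ⊢
    linear_combination q ^ i * q ^ (i * x₃) * hahn q a₁ a₂ i (i + s) x₁ * h2 -
      q ^ k * q ^ (i * x₃) * hahn q (a₁ * a₂ * q ^ (2 * i + 1)) a₃ k (k + m) (s - 1) * h1
      - q ^ i * q ^ k * q ^ (i * x₃) * hahn q a₁ a₂ i (x₁ - 1 + x₂) (x₁ - 1) * e6'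
      - q ^ i * q ^ k * q ^ (i * x₃) * q ^ x₁ * hahn q a₁ a₂ i (x₁ + (x₂ - 1)) x₁ * e7'
      + q ^ i * q ^ k * q ^ s * hahn q (a₁ * a₂ * q ^ (2 * i + 1)) a₃ k (k + m) s *
        hahn q a₁ a₂ i (i + s) x₁ * e5

lemma xiAux_lower {q a₁ a₂ a₃ : ℝ} (hq0 : 0 < q) (hq1 : q < 1)
    (h₁ : ∀ k : ℕ, 1 - a₁ * q ^ (k + 1) ≠ 0) (h₂ : ∀ k : ℕ, 1 - a₂ * q ^ (k + 1) ≠ 0)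
    (h₂0 : a₂ ≠ 0) (h₃0 : a₃ ≠ 0) {n j x₁ x₂ x₃ : ℕ} (hj : j ≤ n)
    (hx : x₁ + x₂ + x₃ + 1 = n) :
    (1 - a₁ * q ^ (x₁ + 1)) * xiAux q a₁ a₂ a₃ n j n (x₁ + 1) x₂ x₃ +
      a₁ * q ^ (x₁ + 1) * (1 - a₂ * q ^ (x₂ + 1)) * xiAux q a₁ a₂ a₃ n j n x₁ (x₂ + 1) x₃ +
      a₁ * a₂ * q ^ (x₁ + x₂ + 2) * (1 - a₃ * q ^ (x₃ + 1)) *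
        xiAux q a₁ a₂ a₃ n j n x₁ x₂ (x₃ + 1) = 0 := by
  have l1 := hahn_lower hq0 hq1 h₃0 h₂ j (x₂ + x₃) x₂
  have l2 := hahn_self_succ hq0 (b := a₂ * a₃ * q ^ (2 * j + 1))
    (mul_ne_zero (mul_ne_zero h₂0 h₃0) (pow_ne_zero _ hq0.ne')) h₁ (n - j) x₁
  unfold xiAux
  rw [show x₂ + 1 + x₃ = x₂ + x₃ + 1 by ring, show x₂ + (x₃ + 1) = x₂ + x₃ + 1 by ring]
  have e : q ^ (2 * j + 1) * q ^ (n - j) = q ^ x₁ * q ^ (j + (x₂ + x₃) + 2) := by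
    rw [← pow_add, ← pow_add]; congr 1; omega
  linear_combination hahn q a₂ a₃ j (x₂ + x₃) x₂ * l2 +
    a₁ * q ^ (x₁ + 1) *
      hahn q a₁ (a₂ * a₃ * q ^ (2 * j + 1)) (n - j) (n - j) x₁ * l1 +
    a₁ * q * a₂ * a₃ * hahn q a₁ (a₂ * a₃ * q ^ (2 * j + 1)) (n - j) (n - j) x₁ *
      hahn q a₂ a₃ j (x₂ + x₃) x₂ * e

lemma thetaAux_lower {q a₁ a₂ a₃ : ℝ} (hq0 : 0 < q) (hq1 : q < 1)
    (h₁ : ∀ k : ℕ, 1 - a₁ * q ^ (k + 1) ≠ 0)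
    (h₁₂ : ∀ k : ℕ, 1 - a₁ * a₂ * q ^ (k + 2) ≠ 0)
    (h₂0 : a₂ ≠ 0) (h₃0 : a₃ ≠ 0) {n i x₁ x₂ x₃ : ℕ} (hi : i ≤ n)
    (hx : x₁ + x₂ + x₃ + 1 = n) :
    (1 - a₁ * q ^ (x₁ + 1)) * thetaAux q a₁ a₂ a₃ n i n (x₁ + 1) x₂ x₃ +
      a₁ * q ^ (x₁ + 1) * (1 - a₂ * q ^ (x₂ + 1)) * thetaAux q a₁ a₂ a₃ n i n x₁ (x₂ + 1) x₃ +
      a₁ * a₂ * q ^ (x₁ + x₂ + 2) * (1 - a₃ * q ^ (x₃ + 1)) *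
        thetaAux q a₁ a₂ a₃ n i n x₁ x₂ (x₃ + 1) = 0 := by
  have l1 := hahn_lower hq0 hq1 h₂0 h₁ i (x₁ + x₂) x₁
  unfold thetaAux
  rw [show x₁ + 1 + x₂ = x₁ + x₂ + 1 by ring, show x₁ + (x₂ + 1) = x₁ + x₂ + 1 by ring]
  rcases lt_or_ge (x₁ + x₂) i with h | h
  · rw [hahn_of_lt h] at l1 ⊢
    linear_combination q ^ (i * x₃) *
      hahn q (a₁ * a₂ * q ^ (2 * i + 1)) a₃ (n - i) (n - i) (x₁ + x₂ + 1 - i) * l1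
  · obtain ⟨s, hs⟩ := Nat.exists_eq_add_of_le h
    have l2 := hahn_self_succ hq0 (a := a₁ * a₂ * q ^ (2 * i + 1)) h₃0
      (fun k => by
        have := h₁₂ (2 * i + k)
        rwa [show 2 * i + k + 2 = 2 * i + 1 + (k + 1) by ring, pow_add, ← mul_assoc] at this)
      (n - i) s
    rw [show q ^ (x₁ + x₂ + 2) = q ^ (i + s + 2) by rw [hs],
      show q ^ (i * (x₃ + 1)) = q ^ (i * x₃) * q ^ i by ring]
    have e : q ^ (n - i) = q ^ s * q ^ (x₃ + 1) := by
      rw [← pow_add]; congr 1; omega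
    rw [hs] at l1 ⊢
    rw [show i + s - i = s by omega, show i + s + 1 - i = s + 1 by omega]
    have e2 : q ^ x₂ * q ^ x₁ = q ^ (i + s) := by rw [← hs]; ring
    linear_combination q ^ (i * x₃) * hahn q a₁ a₂ i (i + s) x₁ * l2 +
      q ^ (i * x₃) * hahn q (a₁ * a₂ * q ^ (2 * i + 1)) a₃ (n - i) (n - i) (s + 1) * l1 +
      q ^ (i * x₃) * a₁ * a₂ * q ^ (2 * i + 2) * a₃ * hahn q a₁ a₂ i (i + s) x₁ *
        hahn q (a₁ * a₂ * q ^ (2 * i + 1)) a₃ (n - i) (n - i) s * e -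
      a₁ * a₂ * q ^ 2 * q ^ (i * x₃) *
        hahn q (a₁ * a₂ * q ^ (2 * i + 1)) a₃ (n - i) (n - i) (s + 1) *
        hahn q a₁ a₂ i (i + s + 1) x₁ * e2

lemma racah_key {q a b d g I K D : ℝ} (hI : I ≠ 0) (hq : q ≠ 0) (hD : D = 1 - a * b * q * I ^ 2)
    (hD0 : D ≠ 0) :
    (1 - d * g * q * K) * (1 - K / I) * (1 - a * b * q * I * K) -
        (1 - a * q * K) * (1 - b * d * q * K) * (1 - g * K) =
      -(q * K) / D *
        ((1 - a * b * q * I * K) * (1 - a * q * I) * (1 - b * d * q * I) * (1 - g * I) / (q * I) +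
          (1 - K / I) * (1 - b * I) * (g - a * b * q * I) * (d - a * I)) := by
  field_simp
  rw [hD]
  ring

lemma coeff_zero {q a₁ a₂ a₃ X Z D₁ D₂ : ℝ} (hX : X ≠ 0) (hZ : Z ≠ 0)
    (hD₁ : D₁ = 1 - a₁ * a₂ * q ^ 2) (hD₂ : D₂ = 1 - a₁ * a₂ * q ^ 2 * X)
    (h₁ : D₁ ≠ 0) (h₂ : D₂ ≠ 0) :
    (1 - a₁ * q * X) * (1 - Z) * (-(a₁ * a₂ * q ^ 2 * (X - a₃ * (X * Z))) / D₂) =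
      -(a₁ * q * X) * ((1 - Z) * (1 - a₂ * a₃ * q * Z) +
        Z * ((1 - a₂ * q) * (1 - a₁ * a₂ * a₃ * q ^ 2 * (X * Z)) * (X * Z - 1) / (X * Z * D₁)) -
        Z * (-((1 - a₁ * a₂ * q ^ 2 * (X * Z)) * (1 - a₁ * a₂ * a₃ * q ^ 2 * (X * Z)) * (1 - X) *
          (1 - a₂ * q)) / (X * Z * D₁ * D₂))) := by
  field_simp
  rw [hD₁, hD₂]
  ring

lemma coeff_frac {k₁ k₂ N L P₁ P₂ P₃ P₄ P₅ Z W D₁ D₂ D₃ D₄ : ℝ}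
    (hW : W ≠ 0) (h₁ : D₁ ≠ 0) (h₂ : D₂ ≠ 0) (h₃ : D₃ ≠ 0) (h₄ : D₄ ≠ 0)
    (h : k₁ * N * W * D₁ * D₂ * D₃ = k₂ * (-(Z * P₁ * D₃ * D₄) +
      L * (P₂ * W * D₁ * D₂ * D₃ * D₄ + Z * (P₃ * D₁ * D₄ + P₄ * D₃ * D₄) - Z * (P₅ * D₁)))) :
    k₁ * (N / D₄) = k₂ * (-(Z * (P₁ / (W * D₁ * D₂))) +
      L * (P₂ + Z * (P₃ / (W * D₂ * D₃) + P₄ / (W * D₁ * D₂)) - Z * (P₅ / (W * D₂ * D₃ * D₄)))) := by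
  field_simp
  linear_combination h

lemma coeff_succ {q a₁ a₂ a₃ X Z I : ℝ} (hX : X ≠ 0) (hZ : Z ≠ 0)
    (h₁ : 1 - a₁ * a₂ * (q * I) ^ 2 ≠ 0) (h₂ : 1 - a₁ * a₂ * q * (q * I) ^ 2 ≠ 0)
    (h₃ : 1 - a₁ * a₂ * q ^ 2 * (q * I) ^ 2 ≠ 0) (h₄ : 1 - a₁ * a₂ * q ^ 2 * (q * I) * X ≠ 0) :
    (1 - a₁ * q * X) * (1 - Z) *
        (-(a₁ * a₂ * q ^ 2 * X * (1 - a₃ * Z) * (1 - q * X) * I) /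
          (1 - a₁ * a₂ * q ^ 2 * (q * I) * X)) =
      -(a₁ * q * X) * (-(Z * ((X * Z - I) * a₂ * q * (1 - q * I) * (1 - a₁ * (q * I)) *
          (I - a₃ * (X * Z)) * (1 - a₁ * a₂ * q * (q * I) * X) /
          (X * Z * (1 - a₁ * a₂ * (q * I) ^ 2) * (1 - a₁ * a₂ * q * (q * I) ^ 2)))) +
        (I - X) * ((1 - Z) * (1 - a₂ * a₃ * q * Z) +
          Z * ((1 - a₂ * q * (q * I)) * (1 - a₁ * a₂ * a₃ * q ^ 2 * (q * I) * (X * Z)) *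
              (X * Z - q * I) * (1 - a₁ * a₂ * q * (q * I)) /
              (X * Z * (1 - a₁ * a₂ * q * (q * I) ^ 2) * (1 - a₁ * a₂ * q ^ 2 * (q * I) ^ 2)) +
            (1 - q * I) * (1 - a₁ * (q * I)) * (1 - a₁ * a₂ * q * (q * I) * (X * Z)) *
              (a₂ * (a₃ * q * (X * Z) - q * I)) /
              (X * Z * (1 - a₁ * a₂ * (q * I) ^ 2) * (1 - a₁ * a₂ * q * (q * I) ^ 2))) -
          Z * (-((1 - a₁ * a₂ * q ^ 2 * (q * I) * (X * Z)) * (1 - a₁ * a₂ * q * (q * I)) *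
              (1 - a₁ * a₂ * a₃ * q ^ 2 * (q * I) * (X * Z)) * (q * I - X) *
              (1 - a₂ * q * (q * I))) /
            (X * Z * (1 - a₁ * a₂ * q * (q * I) ^ 2) * (1 - a₁ * a₂ * q ^ 2 * (q * I) ^ 2) *
              (1 - a₁ * a₂ * q ^ 2 * (q * I) * X))))) := by
  apply coeff_frac (mul_ne_zero hX hZ) h₁ h₂ h₃ h₄
  ring

lemma racah_up_diff {q a b d g I K D₂ D₃ E : ℝ} (hI : I ≠ 0) (hq : q ≠ 0)
   (hD₃ : D₃ = 1 - a * b * q ^ 2 * I ^ 2)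
    (hE : E = 1 - a * b * q * I)
    (h₂ : D₂ ≠ 0) (h₃ : D₃ ≠ 0) (hE0 : E ≠ 0) :
    (1 - a * q * I) * (1 - b * d * q * I) * (1 - g * I) * (E / D₂) / D₃ *
      ((1 - (q * I)⁻¹) * ((1 - a * b * (q * I) * K) * (1 - a * b * (q * I) * (q * K)) / E) -
        (1 - I⁻¹ * K) * (1 - a * b * (q * I) * K)) =
      -((1 - q * K) * ((1 - a * b * q * I * K) * (1 - a * q * I) * (1 - b * d * q * I) *
        (1 - g * I) / (q * I))) / D₂ := by
  field_simp
  rw [hD₃, hE]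
  ring

lemma racah_down_diff {q a b d g I K D₁ D₂ E : ℝ} (hI : I ≠ 0)
    (hD₁ : D₁ = 1 - a * b * I ^ 2) (hE : E = 1 - I)
    (h₁ : D₁ ≠ 0) (h₂ : D₂ ≠ 0) (hE0 : E ≠ 0) :
    E * (1 - b * I) * (g - a * b * q * I) * (d - a * I) / (D₁ * D₂) *
      ((1 - I⁻¹ * K) * (1 - I⁻¹ * (q * K)) / (1 - I⁻¹) * (1 - a * b * I) -
        (1 - I⁻¹ * K) * (1 - a * b * (q * I) * K)) =
      -((1 - q * K) * ((1 - K / I) * (1 - b * I) * (g - a * b * q * I) * (d - a * I))) / D₂ := by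
  have hE' : 1 - I⁻¹ = -E / I := by rw [hE]; field_simp; ring
  rw [hE']
  field_simp
  rw [hD₁, hE]
  ring

lemma racah_scalar {q a b d g y I K D w S T : ℝ} (hK : K ≠ 0) (hq : q ≠ 0) (hy : y ≠ 0)
    (hI : I ≠ 0)
    (key : (1 - d * g * q * K) * (1 - K / I) * (1 - a * b * q * I * K) -
        (1 - a * q * K) * (1 - b * d * q * K) * (1 - g * K) = -(q * K) / D * (S + T))
    (hw : w = (1 - I⁻¹ * K) * (1 - a * b * (q * I) * K)) :
    -((1 - y⁻¹) * (1 - d * g * y)) * w - (-((1 - q * K) * S) / D + -((1 - q * K) * T) / D) =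
      (1 - a * q * K) * (1 - b * d * q * K) * (1 - g * K) * (1 - q * K) / (q * K) -
        w / (q * K) * ((1 - d * g * y * (q * K)) * (1 - y⁻¹ * (q * K))) := by
  have e : (S + T) / D = -((1 - d * g * q * K) * (1 - K / I) * (1 - a * b * q * I * K) -
        (1 - a * q * K) * (1 - b * d * q * K) * (1 - g * K)) / (q * K) := by
    rw [key]; field_simp
  have e' : -((1 - q * K) * S) / D + -((1 - q * K) * T) / D = -(1 - q * K) * ((S + T) / D) := by
    ring
  rw [e', e, hw]
  field_simp
  ring

/-- Summand of the q-Racah series in the variable `y = q ^ x`, with `g = q ^ (-N)`. -/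
def racahTerm (q a b d g y : ℝ) (i k : ℕ) : ℝ :=
  qPoch q (q ^ i)⁻¹ k * qPoch q (a * b * q ^ (i + 1)) k *
    (qPoch q (d * g * y) k * qPoch q y⁻¹ k) /
    (qPoch q (a * q) k * qPoch q (b * d * q) k * qPoch q g k * qPoch q q k) * q ^ k

/-- The terminating balanced series defining the q-Racah polynomial. -/
def racahSum (q a b d g y : ℝ) (i : ℕ) : ℝ :=
  ∑ k ∈ Finset.range (i + 1), racahTerm q a b d g y i k

/-- Numerator and denominator factor common to several coefficients, with the cancellation
at `i = 0` carried out. -/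
def racahRatio (q c : ℝ) (i : ℕ) : ℝ :=
  if i = 0 then 1 else (1 - c * q * q ^ i) / (1 - c * q * (q ^ i) ^ 2)

/-- Upward coefficient in the three-term recurrence. -/
def racahUp (q a b d g : ℝ) (i : ℕ) : ℝ :=
  (1 - a * q * q ^ i) * (1 - b * d * q * q ^ i) * (1 - g * q ^ i) * racahRatio q (a * b) i /
    (1 - a * b * q ^ 2 * (q ^ i) ^ 2)

/-- Downward coefficient in the three-term recurrence. -/
def racahDown (q a b d g : ℝ) (i : ℕ) : ℝ :=
  (1 - q ^ i) * (1 - b * q ^ i) * (g - a * b * q * q ^ i) * (d - a * q ^ i) /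
    ((1 - a * b * (q ^ i) ^ 2) * (1 - a * b * q * (q ^ i) ^ 2))

lemma qPoch_inv_pow_eq_zero {q : ℝ} (hq0 : 0 < q) {i k : ℕ} (h : i < k) :
    qPoch q (q ^ i)⁻¹ k = 0 :=
  Finset.prod_eq_zero (Finset.mem_range.2 h) (by
    rw [inv_mul_cancel₀ (pow_ne_zero _ hq0.ne'), sub_self])

lemma racahSum_eq {q : ℝ} (hq0 : 0 < q) (a b d g y : ℝ) {i K : ℕ} (h : i + 1 ≤ K) :
    racahSum q a b d g y i = ∑ k ∈ Finset.range K, racahTerm q a b d g y i k := by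
  refine Finset.sum_subset (Finset.range_mono h) fun k _ hk => ?_
  rw [Finset.mem_range, not_lt] at hk
  simp [racahTerm, qPoch_inv_pow_eq_zero hq0 (show i < k by omega)]

lemma racahTerm_zero (q a b d g y : ℝ) (i : ℕ) : racahTerm q a b d g y i 0 = 1 := by
  simp [racahTerm, qPoch_zero]

lemma racahTerm_rec {q a b d g y : ℝ} (hq0 : 0 < q) (hq1 : q < 1) {i k : ℕ} (hk : k ≤ i + 1)
    (ha : ∀ k : ℕ, 1 - a * q ^ (k + 1) ≠ 0) (hab : ∀ k : ℕ, 1 - a * b * q ^ (k + 2) ≠ 0)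
    (hbd : ∀ k ≤ i + 1, 1 - b * d * q ^ (k + 1) ≠ 0) (hg : ∀ k ≤ i + 1, 1 - g * q ^ k ≠ 0)
    (hy : y ≠ 0) :
    -((1 - y⁻¹) * (1 - d * g * y)) * racahTerm q a b d g y (i + 1) (k + 1) -
      (racahUp q a b d g (i + 1) *
        (racahTerm q a b d g y (i + 2) (k + 1) - racahTerm q a b d g y (i + 1) (k + 1)) +
       racahDown q a b d g (i + 1) *
        (racahTerm q a b d g y i (k + 1) - racahTerm q a b d g y (i + 1) (k + 1))) =
      racahTerm q a b d g y (i + 1) k / q ^ k *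
        ((1 - d * g * y * q ^ k) * (1 - y⁻¹ * q ^ k)) -
      racahTerm q a b d g y (i + 1) (k + 1) / q ^ (k + 1) *
        ((1 - d * g * y * q ^ (k + 1)) * (1 - y⁻¹ * q ^ (k + 1))) := by
  have hq := hq0.ne'
  have n1 : 1 - a * q * q ^ k ≠ 0 := by
    have := ha k; rwa [pow_succ', ← mul_assoc] at this
  have n2 : 1 - b * d * q * q ^ k ≠ 0 := by
    have := hbd k hk; rwa [pow_succ', ← mul_assoc] at this
  have n3 := hg k hk
  have n4 : 1 - q * q ^ k ≠ 0 := by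
    have := one_sub_pow_succ_ne_zero hq0 hq1 k; rwa [pow_succ'] at this
  have m1 : qPoch q (a * q) k ≠ 0 := qPoch_ne_zero _ _ _ fun l _ => by
    have := ha l; rwa [pow_succ', ← mul_assoc] at this
  have m2 : qPoch q (b * d * q) k ≠ 0 := qPoch_ne_zero _ _ _ fun l hl => by
    have := hbd l (by omega); rwa [pow_succ', ← mul_assoc] at this
  have m3 : qPoch q g k ≠ 0 := qPoch_ne_zero _ _ _ fun l hl => hg l (by omega)
  have m4 := qPoch_self_ne_zero hq0 hq1 k
  have hI : q ^ (i + 1) ≠ 0 := pow_ne_zero _ hq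
  have hK : q ^ k ≠ 0 := pow_ne_zero _ hq
  have p1 : 1 - q ^ (i + 1) ≠ 0 := one_sub_pow_succ_ne_zero hq0 hq1 i
  have d1 : 1 - a * b * (q ^ (i + 1)) ^ 2 ≠ 0 := by
    have := hab (2 * i); rwa [show q ^ (2 * i + 2) = (q ^ (i + 1)) ^ 2 by ring] at this
  have d2 : 1 - a * b * q * (q ^ (i + 1)) ^ 2 ≠ 0 := by
    have := hab (2 * i + 1)
    rwa [show a * b * q ^ (2 * i + 1 + 2) = a * b * q * (q ^ (i + 1)) ^ 2 by ring] at this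
  have d3 : 1 - a * b * q ^ 2 * (q ^ (i + 1)) ^ 2 ≠ 0 := by
    have := hab (2 * i + 2)
    rwa [show a * b * q ^ (2 * i + 2 + 2) = a * b * q ^ 2 * (q ^ (i + 1)) ^ 2 by ring] at this
  have d4 : 1 - a * b * q * q ^ (i + 1) ≠ 0 := by
    have := hab i
    rwa [show a * b * q ^ (i + 2) = a * b * q * q ^ (i + 1) by ring] at this
  -- the six factors depending on the degree, in terms of the two for degree `i + 1`
  have f1 : qPoch q (q ^ (i + 2))⁻¹ (k + 1) =
      (1 - (q * q ^ (i + 1))⁻¹) * qPoch q (q ^ (i + 1))⁻¹ k := by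
    rw [qPoch_succ', show (q ^ (i + 2))⁻¹ * q = (q ^ (i + 1))⁻¹ by
      rw [pow_succ q (i + 1)]; field_simp, show q ^ (i + 2) = q * q ^ (i + 1) by ring]
  have f2 : qPoch q (q ^ i)⁻¹ (k + 1) = qPoch q (q ^ (i + 1))⁻¹ k *
      (1 - (q ^ (i + 1))⁻¹ * q ^ k) * (1 - (q ^ (i + 1))⁻¹ * q ^ (k + 1)) /
        (1 - (q ^ (i + 1))⁻¹) := by
    have hp : 1 - (q ^ (i + 1))⁻¹ ≠ 0 := by
      rw [sub_ne_zero]; intro h; apply p1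
      rw [← inv_inv (q ^ (i + 1)), ← h]; simp
    rw [eq_div_iff hp, ← qPoch_succ, ← qPoch_succ, qPoch_succ' q _ (k + 1),
      show (q ^ (i + 1))⁻¹ * q = (q ^ i)⁻¹ by rw [pow_succ]; field_simp]
    ring
  have f3 : qPoch q (a * b * q ^ (i + 1)) (k + 1) =
      (1 - a * b * q ^ (i + 1)) * qPoch q (a * b * q ^ (i + 2)) k := by
    rw [qPoch_succ']; congr 2; ring
  have f4 : qPoch q (a * b * q ^ (i + 3)) (k + 1) = qPoch q (a * b * q ^ (i + 2)) k *
      (1 - a * b * q ^ (i + 2) * q ^ k) * (1 - a * b * q ^ (i + 2) * q ^ (k + 1)) /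
        (1 - a * b * q * q ^ (i + 1)) := by
    rw [eq_div_iff d4, ← qPoch_succ, ← qPoch_succ, qPoch_succ' q _ (k + 1), mul_comm]
    congr 2 <;> ring
  have key := racah_key (d := d) (g := g) (K := q ^ k) hI hq rfl d2
  simp only [racahTerm, racahUp, racahDown, racahRatio, Nat.succ_ne_zero, if_false,
    show i + 1 + 1 = i + 2 by ring, show i + 2 + 1 = i + 3 by ring]
  rw [f1, f2, f3, f4]
  simp only [qPoch_succ]
  have e2 : q ^ (i + 2) = q * q ^ (i + 1) := by ring
  have e3 : q ^ (k + 1) = q * q ^ k := by ring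
  have d2' := d2
  rw [e2, e3]
  generalize q ^ (i + 1) = I at *
  generalize q ^ k = K at *
  have hA := racah_up_diff (a := a) (b := b) (d := d) (g := g) (K := K) hI hq rfl rfl d2 d3 d4
  have hC := racah_down_diff (q := q) (a := a) (b := b) (d := d) (g := g) (K := K) hI rfl rfl
    d1 d2 p1
  have hS := racah_scalar (w := (1 - I⁻¹ * K) * (1 - a * b * (q * I) * K)) hK hq hy hI key rfl
  rw [← hA, ← hC] at hS
  generalize qPoch q (d * g * y) k = B₁
  generalize qPoch q y⁻¹ k = B₂
  generalize qPoch q I⁻¹ k = P₁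
  generalize qPoch q (a * b * (q * I)) k = P₂
  generalize qPoch q (a * q) k = M₁ at *
  generalize qPoch q (b * d * q) k = M₂ at *
  generalize qPoch q g k = M₃ at *
  generalize qPoch q q k = M₄ at *
  have hlow : P₁ * P₂ * (B₁ * B₂) / (M₁ * M₂ * M₃ * M₄) * K / K *
        ((1 - d * g * y * K) * (1 - y⁻¹ * K)) =
      P₁ * P₂ * (B₁ * (1 - d * g * y * K) * (B₂ * (1 - y⁻¹ * K))) /
        (M₁ * (1 - a * q * K) * (M₂ * (1 - b * d * q * K)) * (M₃ * (1 - g * K)) *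
          (M₄ * (1 - q * K))) * (q * K) *
        ((1 - a * q * K) * (1 - b * d * q * K) * (1 - g * K) * (1 - q * K) / (q * K)) := by
    generalize 1 - a * q * K = N₁ at *
    generalize 1 - b * d * q * K = N₂ at *
    generalize 1 - g * K = N₃ at *
    generalize 1 - q * K = N₄ at *
    field_simp
  rw [hlow]
  linear_combination (P₁ * P₂ * (B₁ * (1 - d * g * y * K) * (B₂ * (1 - y⁻¹ * K))) /
        (M₁ * (1 - a * q * K) * (M₂ * (1 - b * d * q * K)) * (M₃ * (1 - g * K)) *
          (M₄ * (1 - q * K))) * (q * K)) * hS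

/-- The three-term recurrence of the q-Racah series in its degree. -/
lemma racahSum_rec {q a b d g y : ℝ} (hq0 : 0 < q) (hq1 : q < 1) {i : ℕ}
    (ha : ∀ k : ℕ, 1 - a * q ^ (k + 1) ≠ 0) (hab : ∀ k : ℕ, 1 - a * b * q ^ (k + 2) ≠ 0)
    (hbd : ∀ k ≤ i, 1 - b * d * q ^ (k + 1) ≠ 0) (hg : ∀ k ≤ i, 1 - g * q ^ k ≠ 0)
    (hy : y ≠ 0) :
    -((1 - y⁻¹) * (1 - d * g * y)) * racahSum q a b d g y i =
      racahUp q a b d g i * (racahSum q a b d g y (i + 1) - racahSum q a b d g y i) +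
      racahDown q a b d g i * (racahSum q a b d g y (i - 1) - racahSum q a b d g y i) := by
  rcases i with _ | i
  · have n1 := ha 0
    have n2 := hab 0
    have n3 := hbd 0 le_rfl
    have n4 := hg 0 le_rfl
    have n5 := one_sub_pow_succ_ne_zero hq0 hq1 0
    have hq := hq0.ne'
    simp only [racahSum, racahUp, racahDown, racahRatio, racahTerm, Finset.sum_range_succ,
      Finset.sum_range_zero, qPoch, Finset.prod_range_succ, Finset.prod_range_zero, if_true] at *
    simp only [zero_add, pow_zero, mul_one, pow_one, sub_self, zero_mul, zero_div,
      one_mul, div_one, one_pow, add_zero, add_sub_cancel_left, one_add_one_eq_two] at *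
    have n6 : 1 - q⁻¹ = -(1 - q) / q := by field_simp; ring
    rw [n6]
    generalize 1 - a * q = N₁ at *
    generalize 1 - b * d * q = N₂ at *
    generalize 1 - g = N₃ at *
    generalize 1 - q = N₄ at *
    generalize 1 - a * b * q ^ 2 = N₅ at *
    generalize 1 - y⁻¹ = N₆ at *
    field_simp
  · rw [racahSum_eq hq0 a b d g y (show i + 1 + 1 ≤ i + 3 by omega),
      racahSum_eq hq0 a b d g y (show i + 1 + 1 + 1 ≤ i + 3 by omega),
      racahSum_eq hq0 a b d g y (show i + 1 - 1 + 1 ≤ i + 3 by omega)]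
    have tel : ∀ k ≤ i + 2, ∑ k ∈ Finset.range (k + 1),
        (-((1 - y⁻¹) * (1 - d * g * y)) * racahTerm q a b d g y (i + 1) k -
        (racahUp q a b d g (i + 1) *
          (racahTerm q a b d g y (i + 2) k - racahTerm q a b d g y (i + 1) k) +
         racahDown q a b d g (i + 1) *
          (racahTerm q a b d g y i k - racahTerm q a b d g y (i + 1) k))) =
        - (racahTerm q a b d g y (i + 1) k / q ^ k *
        ((1 - d * g * y * q ^ k) * (1 - y⁻¹ * q ^ k))) := by
      intro k hk
      induction k with
      | zero =>
        simp only [zero_add, Finset.sum_range_one, racahTerm_zero]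
        simp
        ring
      | succ k ih =>
        rw [Finset.sum_range_succ, ih (by omega),
          racahTerm_rec hq0 hq1 (by omega) ha hab hbd hg hy]
        ring
    have h := tel (i + 2) le_rfl
    have hz : racahTerm q a b d g y (i + 1) (i + 2) = 0 := by
      simp [racahTerm, qPoch_inv_pow_eq_zero hq0 (show i + 1 < i + 2 by omega)]
    rw [hz, zero_div, zero_mul, neg_zero, Finset.sum_sub_distrib, Finset.sum_add_distrib,
      ← Finset.mul_sum, ← Finset.mul_sum, ← Finset.mul_sum, Finset.sum_sub_distrib,
      Finset.sum_sub_distrib] at h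
    exact sub_eq_zero.1 h

lemma hahn_top_raise {q : ℝ} (hq0 : 0 < q) (hq1 : q < 1) (a b : ℝ) (n N : ℕ) :
    (q ^ n - q ^ (N + 1)) * hahn q a b n (N + 1) (N + 1) =
      q ^ n * (1 - q ^ (N + 1)) * hahn q a b n N N := by
  have := hahn_raise hq0 hq1 a b n N (N + 1)
  rw [Nat.add_sub_cancel] at this
  linear_combination this

lemma hahn_zero_top {q : ℝ} (hq0 : 0 < q) (hq1 : q < 1) (a b : ℝ) (N : ℕ) :
    hahn q a b 0 N N = 1 := by
  induction N with
  | zero => simp [hahn, hahnAux, qPoch_zero]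
  | succ N ih =>
    have := hahn_top_raise hq0 hq1 a b 0 N
    rw [ih, pow_zero, one_mul] at this
    exact mul_left_cancel₀ (one_sub_pow_succ_ne_zero hq0 hq1 N) this

lemma pow_sub_pow_ne_zero {q : ℝ} (hq0 : 0 < q) (hq1 : q < 1) {n m : ℕ} (h : n < m) :
    q ^ n - q ^ m ≠ 0 := (sub_pos.2 (pow_lt_pow_right_of_lt_one₀ hq0 hq1 h)).ne'

lemma hahn_top_succ {q a b : ℝ} (hq0 : 0 < q) (hq1 : q < 1) (hb : b ≠ 0)
    (ha : ∀ k : ℕ, 1 - a * q ^ (k + 1) ≠ 0) (n N : ℕ) :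
    (1 - a * q * q ^ n) * hahn q a b (n + 1) (N + 1) (N + 1) =
      -(a * q * q ^ n * (1 - q * q ^ N) * (1 - b * q * q ^ n)) * hahn q a b n N N := by
  rcases lt_or_ge N n with h | h
  · rw [hahn_of_lt h, hahn_of_lt (show N + 1 < n + 1 by omega)]; simp
  · induction N, h using Nat.le_induction with
    | base =>
      simp only [hahn, le_refl, if_true, Nat.sub_self, hahnAux]
      have h1 : qPoch q (a * q) n ≠ 0 := qPoch_ne_zero _ _ _ fun k _ => by
        have := ha k
        rwa [pow_succ', ← mul_assoc] at this
      have h3 : (1 - a * q * q ^ n) ≠ 0 := by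
        have := ha n
        rwa [pow_succ', ← mul_assoc] at this
      have hq := hq0.ne'
      rw [qPoch_succ' q (b⁻¹ * q ^ (-((n + 1 : ℕ) : ℤ))),
        show b⁻¹ * q ^ (-((n + 1 : ℕ) : ℤ)) * q = b⁻¹ * q ^ (-(n : ℤ)) by
          rw [zpow_neg, zpow_neg, zpow_natCast, zpow_natCast]; field_simp; ring,
        qPoch_succ q (a * q), qPoch_succ q q]
      generalize qPoch q (b⁻¹ * q ^ (-(n : ℤ))) n = P
      generalize qPoch q (a * q) n = P₁ at *
      generalize 1 - a * q * q ^ n = D at *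
      rw [zpow_neg, zpow_natCast]
      field_simp
      ring
    | succ N hN ih =>
      have r1 := hahn_top_raise hq0 hq1 a b n N
      have r2 := hahn_top_raise hq0 hq1 a b (n + 1) (N + 1)
      apply mul_left_cancel₀ (pow_sub_pow_ne_zero hq0 hq1 (show n + 1 < N + 1 + 1 by omega))
      linear_combination (1 - a * q * q ^ n) * r2 + q * q ^ n * (1 - q * q ^ (N + 1)) * ih +
        q * a * q * q ^ n * (1 - q * q ^ (N + 1)) * (1 - b * q * q ^ n) * r1

lemma hahn_top_succ_same {q a b : ℝ} (hq0 : 0 < q) (hq1 : q < 1) (hb : b ≠ 0)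
    (ha : ∀ k : ℕ, 1 - a * q ^ (k + 1) ≠ 0) (n N : ℕ) :
    (1 - a * q * q ^ n) * hahn q a b (n + 1) N N =
      -(a * q * (q ^ n - q ^ N) * (1 - b * q * q ^ n)) * hahn q a b n N N := by
  have r1 := hahn_top_raise hq0 hq1 a b (n + 1) N
  have r2 := hahn_top_succ hq0 hq1 hb ha n N
  have hq := hq0.ne'
  apply mul_left_cancel₀ (mul_ne_zero (pow_ne_zero (n + 1) hq)
    (one_sub_pow_succ_ne_zero hq0 hq1 N))
  linear_combination (q ^ (n + 1) - q ^ (N + 1)) * r2 - (1 - a * q * q ^ n) * r1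

lemma hahn_at_zero {q : ℝ} (hq0 : 0 < q) (hq1 : q < 1) (a b : ℝ) (n m : ℕ) :
    qPoch q q m * hahn q a b n (n + m) 0 = qPoch q q (n + m) := by
  induction m with
  | zero => simp [hahn_self_zero, qPoch_zero]
  | succ m ih =>
    have r := hahn_raise hq0 hq1 a b n (n + m) 0
    apply mul_left_cancel₀ (pow_ne_zero n hq0.ne')
    rw [show n + (m + 1) = n + m + 1 by ring, qPoch_succ, qPoch_succ, ← ih]
    linear_combination qPoch q q m * r

/-- Simultaneous shift of degree and first parameter for extremal q-Hahn polynomials. -/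
lemma hahn_self_shift {q a b : ℝ} (hq0 : 0 < q) (hb : b ≠ 0)
    (ha : ∀ k : ℕ, 1 - a * q ^ (k + 1) ≠ 0) (m y : ℕ) :
    hahn q a b (m + 1) (m + 1) (y + 1) * ((1 - a * q) * (1 - a * q ^ 2) * q ^ y) =
      hahn q (a * q ^ 2) b m m y *
        ((1 - q * q ^ m) * (a * q) * (b * q * q ^ m - 1) * (1 - a * q ^ 2 * q ^ y)) := by
  simp only [hahn, le_refl, if_true, Nat.sub_self, hahnAux]
  have hq := hq0.ne'
  have hn : ∀ k, 1 - a * q * q ^ k ≠ 0 := fun k => by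
    have := ha k
    rwa [pow_succ', ← mul_assoc] at this
  have h1 : qPoch q (a * q) (y + 1) ≠ 0 := qPoch_ne_zero _ _ _ fun k _ => hn k
  have h2 : qPoch q (a * q ^ 2 * q) y ≠ 0 := qPoch_ne_zero _ _ _ fun k _ => by
    have := ha (k + 2)
    rwa [show a * q ^ (k + 2 + 1) = a * q ^ 2 * q * q ^ k by ring] at this
  have e : qPoch q (a * q) (y + 1) * (1 - a * q ^ 2 * q ^ y) =
      (1 - a * q) * (1 - a * q ^ 2) * qPoch q (a * q ^ 2 * q) y := by
    rw [show a * q ^ 2 * q ^ y = a * q * q ^ (y + 1) by ring, ← qPoch_succ, qPoch_succ',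
      qPoch_succ']
    rw [show a * q * q = a * q ^ 2 by ring]
    ring
  rw [qPoch_succ' q (b⁻¹ * q ^ (-((m + 1 : ℕ) : ℤ))),
    show b⁻¹ * q ^ (-((m + 1 : ℕ) : ℤ)) * q = b⁻¹ * q ^ (-(m : ℤ)) by
      rw [zpow_neg, zpow_neg, zpow_natCast, zpow_natCast]; field_simp; ring, qPoch_succ q q]
  generalize qPoch q (b⁻¹ * q ^ (-(m : ℤ))) y = P
  rw [zpow_neg, zpow_natCast]
  generalize qPoch q (a * q) (y + 1) = P₁ at *
  generalize qPoch q (a * q ^ 2 * q) y = P₂ at *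
  have e' : (1 - a * q) * (1 - a * q ^ 2) / P₁ = (1 - a * q ^ 2 * q ^ y) / P₂ := by
    rw [div_eq_div_iff h1 h2]; linear_combination -e
  have e3 : (a * b * q ^ (m + 1 + 1)) ^ (y + 1) * q ^ y * (1 - b⁻¹ * (q ^ (m + 1))⁻¹) =
      (a * q ^ 2 * b * q ^ (m + 1)) ^ y * (a * q) * (b * q * q ^ m - 1) := by
    have e4 : a * q ^ 2 * b * q ^ (m + 1) = a * b * q ^ (m + 1 + 1) * q := by ring
    rw [e4, mul_pow (a * b * q ^ (m + 1 + 1)) q, pow_succ (a * b * q ^ (m + 1 + 1))]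
    field_simp
    ring
  linear_combination (qPoch q q m * (1 - q * q ^ m) * P *
    (a * b * q ^ (m + 1 + 1)) ^ (y + 1) * q ^ y * (1 - b⁻¹ * (q ^ (m + 1))⁻¹)) * e' +
    qPoch q q m * (1 - q * q ^ m) * P * ((1 - a * q ^ 2 * q ^ y) / P₂) * e3

/-- The normalizing factor of the q-Racah polynomial. -/
def racahNorm (q a b d : ℝ) (n i : ℕ) : ℝ :=
  q ^ (-((i * (n - i) : ℕ) : ℤ)) *
    (qPoch q (b * d * q) i * qPoch q (q ^ (n - i + 1)) i /
      (qPoch q (a * b * q ^ (i + 1)) i * qPoch q q i))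

lemma racahNorm_zero (q a b d : ℝ) (n : ℕ) : racahNorm q a b d n 0 = 1 := by
  simp [racahNorm, qPoch_zero]

lemma racahNorm_succ {q a b : ℝ} (hq0 : 0 < q) (hq1 : q < 1) (d : ℝ)
    (hab : ∀ k : ℕ, 1 - a * b * q ^ (k + 2) ≠ 0) (i k : ℕ) :
    racahNorm q a b d (i + 1 + k) (i + 1) =
      racahNorm q a b d (i + 1 + k) i *
        (q ^ i * (1 - b * d * q * q ^ i) * (1 - q * q ^ k) * racahRatio q (a * b) i /
          (q ^ k * (1 - a * b * q ^ 2 * (q ^ i) ^ 2) * (1 - q * q ^ i))) := by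
  have hq := hq0.ne'
  have d1 : 1 - a * b * q ^ 2 * (q ^ i) ^ 2 ≠ 0 := by
    have := hab (2 * i)
    rwa [show a * b * q ^ (2 * i + 2) = a * b * q ^ 2 * (q ^ i) ^ 2 by ring] at this
  have d2 : 1 - q * q ^ i ≠ 0 := by
    have := one_sub_pow_succ_ne_zero hq0 hq1 i
    rwa [pow_succ'] at this
  have m4 := qPoch_self_ne_zero hq0 hq1 i
  have m3 : qPoch q (a * b * q ^ (i + 1)) i ≠ 0 := qPoch_ne_zero _ _ _ fun l hl => by
    have := hab (i - 1 + l)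
    rwa [show i - 1 + l + 2 = i + 1 + l by omega, pow_add, ← mul_assoc] at this
  have m5 : qPoch q (a * b * q ^ (i + 2)) (i + 1) ≠ 0 := qPoch_ne_zero _ _ _ fun l _ => by
    have := hab (i + l)
    rwa [show i + l + 2 = i + 2 + l by omega, pow_add, ← mul_assoc] at this
  have e : qPoch q (a * b * q ^ (i + 1)) i * (1 - a * b * q ^ 2 * (q ^ i) ^ 2) =
      racahRatio q (a * b) i * qPoch q (a * b * q ^ (i + 2)) (i + 1) := by
    rcases i with _ | i
    · simp [racahRatio, qPoch]
    · have d3 : 1 - a * b * q * (q ^ (i + 1)) ^ 2 ≠ 0 := by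
        have := hab (2 * i + 1)
        rwa [show a * b * q ^ (2 * i + 1 + 2) = a * b * q * (q ^ (i + 1)) ^ 2 by ring] at this
      have h1 := qPoch_succ' q (a * b * q ^ (i + 1 + 1)) (i + 1 + 1)
      rw [qPoch_succ, qPoch_succ, show a * b * q ^ (i + 1 + 1) * q = a * b * q ^ (i + 1 + 2) by ring,
        show a * b * q ^ (i + 1 + 1) * q ^ (i + 1) = a * b * q * (q ^ (i + 1)) ^ 2 by ring,
        show a * b * q ^ (i + 1 + 1) * q ^ (i + 1 + 1) = a * b * q ^ 2 * (q ^ (i + 1)) ^ 2 by ring,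
        show 1 - a * b * q ^ (i + 1 + 1) = 1 - a * b * q * q ^ (i + 1) by ring] at h1
      simp only [racahRatio, Nat.succ_ne_zero, if_false]
      rw [div_mul_eq_mul_div, eq_div_iff d3, ← h1]
      ring
  simp only [racahNorm]
  rw [show i + 1 + k - (i + 1) = k by omega, show i + 1 + k - i = k + 1 by omega,
    qPoch_succ' q (q ^ (k + 1)), qPoch_succ q (b * d * q), qPoch_succ q q,
    show q ^ (k + 1) * q = q ^ (k + 1 + 1) by ring, show i + 1 + 1 = i + 2 by ring,
    zpow_neg, zpow_neg, zpow_natCast, zpow_natCast, show (i + 1) * k = i * k + k by ring,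
    show i * (k + 1) = i * k + i by ring, pow_add q (i * k), pow_add q (i * k), pow_succ' q k]
  generalize qPoch q (a * b * q ^ (i + 1)) i = M₃ at *
  generalize qPoch q (a * b * q ^ (i + 2)) (i + 1) = M₅ at *
  generalize 1 - a * b * q ^ 2 * (q ^ i) ^ 2 = D₁ at *
  generalize 1 - q * q ^ i = D₂ at *
  have e' : racahRatio q (a * b) i = M₃ * D₁ / M₅ := by rw [eq_div_iff m5, e]
  rw [e']
  field_simp

/-- The coefficient of the `i`-th q-Racah series in the expansion, at the point `(x, 0, z)`. -/
def edgeCoeff (q a₁ a₂ a₃ : ℝ) (n i x z : ℕ) : ℝ :=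
  racahNorm q a₂ a₁ (a₂ * a₃ * q ^ (n + 1)) n i * thetaAux q a₁ a₂ a₃ n i n x 0 z

/-- Factor common to the ratios of consecutive coefficients, with `I = q ^ i`, `X = q ^ x` and
`W = q ^ n`. -/
def edgeRatio (q a₁ a₂ a₃ : ℝ) (i : ℕ) (X W : ℝ) : ℝ :=
  racahRatio q (a₁ * a₂) i * (1 - a₁ * a₂ * a₃ * q ^ 2 * q ^ i * W) *
      (1 - a₁ * a₂ * q ^ 3 * (q ^ i) ^ 2) * (1 - a₂ * q * q ^ i) /
    (a₂ * q * (1 - q * q ^ i) * (1 - a₁ * q * q ^ i) * (q ^ i - a₃ * W) *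
      (1 - a₁ * a₂ * q ^ 2 * q ^ i * X))

lemma edgeCoeff_eq (q a₁ a₂ a₃ : ℝ) (n i x z : ℕ) :
    edgeCoeff q a₁ a₂ a₃ n i x z = racahNorm q a₂ a₁ (a₂ * a₃ * q ^ (n + 1)) n i *
      (q ^ (i * z) * (hahn q (a₁ * a₂ * q ^ (2 * i + 1)) a₃ (n - i) (n - i) (x - i) *
        hahn q a₁ a₂ i x x)) := rfl

lemma edgeCoeff_of_lt (q a₁ a₂ a₃ : ℝ) {n i x : ℕ} (h : x < i) (z : ℕ) :
    edgeCoeff q a₁ a₂ a₃ n i x z = 0 := by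
  rw [edgeCoeff_eq, hahn_of_lt h]; simp

/-- The standing assumptions `0 < q < 1` and `0 < aᵢ < q⁻¹` on the parameters. -/
structure Admissible (q a₁ a₂ a₃ : ℝ) : Prop where
  q_pos : 0 < q
  q_lt : q < 1
  pos₁ : 0 < a₁
  pos₂ : 0 < a₂
  pos₃ : 0 < a₃
  mul_lt₁ : a₁ * q < 1
  mul_lt₂ : a₂ * q < 1
  mul_lt₃ : a₃ * q < 1

namespace Admissible

variable {q a₁ a₂ a₃ : ℝ}

lemma one_sub_ne (h : Admissible q a₁ a₂ a₃) {a : ℝ} (ha : 0 < a) (ha' : a * q < 1) (k : ℕ) :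
    1 - a * q ^ (k + 1) ≠ 0 :=
  (one_sub_mul_pow_pos h.q_pos h.q_lt k ha' ha).ne'

lemma ne₁ (h : Admissible q a₁ a₂ a₃) (k : ℕ) : 1 - a₁ * q ^ (k + 1) ≠ 0 :=
  h.one_sub_ne h.pos₁ h.mul_lt₁ k

lemma ne₂ (h : Admissible q a₁ a₂ a₃) (k : ℕ) : 1 - a₂ * q ^ (k + 1) ≠ 0 :=
  h.one_sub_ne h.pos₂ h.mul_lt₂ k

lemma ne₃ (h : Admissible q a₁ a₂ a₃) (k : ℕ) : 1 - a₃ * q ^ (k + 1) ≠ 0 :=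
  h.one_sub_ne h.pos₃ h.mul_lt₃ k

lemma ne₁₂ (h : Admissible q a₁ a₂ a₃) (k : ℕ) : 1 - a₁ * a₂ * q ^ (k + 2) ≠ 0 := by
  have h0 := h.q_pos
  have := h.one_sub_ne (a := a₁ * (a₂ * q)) (mul_pos h.pos₁ (mul_pos h.pos₂ h0)) (by
    calc a₁ * (a₂ * q) * q = (a₁ * q) * (a₂ * q) := by ring
      _ < 1 := mul_lt_one_of_nonneg_of_lt_one_left (mul_pos h.pos₁ h0).le h.mul_lt₁ h.mul_lt₂.le) k
  rwa [show a₁ * (a₂ * q) * q ^ (k + 1) = a₁ * a₂ * q ^ (k + 2) by ring] at this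

lemma ne₁₂₃ (h : Admissible q a₁ a₂ a₃) (k : ℕ) : 1 - a₁ * a₂ * a₃ * q ^ (k + 3) ≠ 0 := by
  have h0 := h.q_pos
  have e : (a₁ * q) * (a₂ * q) < 1 :=
    mul_lt_one_of_nonneg_of_lt_one_left (mul_pos h.pos₁ h0).le h.mul_lt₁ h.mul_lt₂.le
  have := h.one_sub_ne (a := (a₁ * q) * (a₂ * q) * a₃)
    (mul_pos (mul_pos (mul_pos h.pos₁ h0) (mul_pos h.pos₂ h0)) h.pos₃) (by
    rw [mul_assoc]
    exact mul_lt_one_of_nonneg_of_lt_one_left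
      (mul_pos (mul_pos h.pos₁ h0) (mul_pos h.pos₂ h0)).le e h.mul_lt₃.le) k
  rwa [show a₁ * q * (a₂ * q) * a₃ * q ^ (k + 1) = a₁ * a₂ * a₃ * q ^ (k + 3) by ring] at this

end Admissible

lemma edgeCoeff_succ_index {q a₁ a₂ a₃ : ℝ} (h : Admissible q a₁ a₂ a₃) {n i x z : ℕ}
    (hn : x + z = n) :
    edgeCoeff q a₁ a₂ a₃ n (i + 1) x z =
      edgeCoeff q a₁ a₂ a₃ n i x z *
        (edgeRatio q a₁ a₂ a₃ i (q ^ x) (q ^ n) * (q ^ i - q ^ x)) := by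
  rcases lt_trichotomy x i with hi | hi | hi
  · rw [edgeCoeff_of_lt _ _ _ _ hi, edgeCoeff_of_lt _ _ _ _ (by omega), zero_mul]
  · rw [edgeCoeff_of_lt _ _ _ _ (by omega), hi]; simp
  obtain ⟨y, rfl⟩ := Nat.exists_eq_add_of_lt hi
  obtain ⟨k, hk⟩ : ∃ k, k = y + z := ⟨_, rfl⟩
  obtain rfl : n = i + 1 + k := by omega
  have hq := h.q_pos.ne'
  have r1 := racahNorm_succ (a := a₂) (b := a₁) h.q_pos h.q_lt (a₂ * a₃ * q ^ (i + 1 + k + 1))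
    (fun k => by rw [mul_comm a₂]; exact h.ne₁₂ k) i k
  have r2 := hahn_self_shift (a := a₁ * a₂ * q ^ (2 * i + 1)) h.q_pos h.pos₃.ne' (fun l => by
    have := h.ne₁₂ (2 * i + l)
    rwa [show 2 * i + l + 2 = 2 * i + 1 + (l + 1) by ring, pow_add, ← mul_assoc] at this) k y
  have r3 := hahn_top_succ_same h.q_pos h.q_lt h.pos₂.ne' h.ne₁ i (i + y + 1)
  rw [edgeCoeff_eq, edgeCoeff_eq, r1, show i + 1 + k - (i + 1) = k by omega,
    show i + 1 + k - i = k + 1 by omega, show i + y + 1 - (i + 1) = y by omega,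
    show i + y + 1 - i = y + 1 by omega, edgeRatio]
  rw [show a₁ * a₂ * q ^ (2 * i + 1) * q ^ 2 = a₁ * a₂ * q ^ (2 * (i + 1) + 1) by ring] at r2
  have n1 : 1 - a₁ * q * q ^ i ≠ 0 := by
    have := h.ne₁ i; rwa [pow_succ', ← mul_assoc] at this
  have n2 : 1 - q * q ^ k ≠ 0 := by
    have := one_sub_pow_succ_ne_zero h.q_pos h.q_lt k; rwa [pow_succ'] at this
  have n3 : 1 - q * q ^ i ≠ 0 := by
    have := one_sub_pow_succ_ne_zero h.q_pos h.q_lt i; rwa [pow_succ'] at this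
  have n4 : 1 - a₃ * q * q ^ k ≠ 0 := by
    have := h.ne₃ k; rwa [pow_succ', ← mul_assoc] at this
  have n5 : 1 - a₁ * a₂ * q ^ 2 * (q ^ i) ^ 2 ≠ 0 := by
    have := h.ne₁₂ (2 * i)
    rwa [show a₁ * a₂ * q ^ (2 * i + 2) = a₁ * a₂ * q ^ 2 * (q ^ i) ^ 2 by ring] at this
  have n6 : 1 - a₁ * a₂ * q ^ 3 * (q ^ i) ^ 2 * q ^ y ≠ 0 := by
    have := h.ne₁₂ (2 * i + y + 1)
    rwa [show a₁ * a₂ * q ^ (2 * i + y + 1 + 2) =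
      a₁ * a₂ * q ^ 3 * (q ^ i) ^ 2 * q ^ y by ring] at this
  have hI : q ^ i ≠ 0 := pow_ne_zero _ hq
  have hY : q ^ y ≠ 0 := pow_ne_zero _ hq
  have hZ : q ^ z ≠ 0 := pow_ne_zero _ hq
  have hKe : q ^ k = q ^ y * q ^ z := by rw [hk, pow_add]
  rw [show q ^ ((i + 1) * z) = q ^ (i * z) * q ^ z by ring,
    show q ^ (i + 1 + k) = q * q ^ i * q ^ k by ring, show q ^ (i + y + 1) = q * q ^ i * q ^ y by ring]
  rw [show a₁ * (a₂ * a₃ * q ^ (i + 1 + k + 1)) * q * q ^ i =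
      a₁ * a₂ * a₃ * q ^ 2 * q ^ i * (q * q ^ i * q ^ k) by ring,
    show a₂ * a₁ = a₁ * a₂ by ring]
  rw [show q ^ (i + y + 1) = q * q ^ i * q ^ y by ring] at r3
  rw [show (1 - a₁ * a₂ * q ^ (2 * i + 1) * q) * (1 - a₁ * a₂ * q ^ (2 * (i + 1) + 1)) * q ^ y =
    (1 - a₁ * a₂ * q ^ 2 * (q ^ i) ^ 2) * (1 - a₁ * a₂ * q ^ 3 * (q ^ i) ^ 2) * q ^ y by ring,
    show (1 - q * q ^ k) * (a₁ * a₂ * q ^ (2 * i + 1) * q) * (a₃ * q * q ^ k - 1) *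
      (1 - a₁ * a₂ * q ^ (2 * (i + 1) + 1) * q ^ y) =
      -((1 - q * q ^ k) * (a₁ * a₂ * q ^ 2 * (q ^ i) ^ 2) * (1 - a₃ * q * q ^ k) *
      (1 - a₁ * a₂ * q ^ 3 * (q ^ i) ^ 2 * q ^ y)) by ring] at r2
  rw [show q ^ i - a₃ * (q * q ^ i * q ^ k) = q ^ i * (1 - a₃ * q * q ^ k) by ring,
    show 1 - a₁ * a₂ * q ^ 2 * q ^ i * (q * q ^ i * q ^ y) =
      1 - a₁ * a₂ * q ^ 3 * (q ^ i) ^ 2 * q ^ y by ring]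
  generalize hahn q (a₁ * a₂ * q ^ (2 * (i + 1) + 1)) a₃ k k y = H' at *
  generalize hahn q (a₁ * a₂ * q ^ (2 * i + 1)) a₃ (k + 1) (k + 1) (y + 1) = H at *
  generalize hahn q a₁ a₂ i (i + y + 1) (i + y + 1) = T at *
  generalize hahn q a₁ a₂ (i + 1) (i + y + 1) (i + y + 1) = T' at *
  have h1 := h.pos₁.ne'
  have h2 := h.pos₂.ne'
  generalize 1 - a₁ * a₂ * q ^ 3 * (q ^ i) ^ 2 * q ^ y = N₆ at *
  generalize 1 - a₁ * a₂ * q ^ 3 * (q ^ i) ^ 2 = M₆ at *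
  generalize 1 - a₁ * a₂ * q ^ 2 * (q ^ i) ^ 2 = N₅ at *
  generalize 1 - a₁ * a₂ * a₃ * q ^ 2 * q ^ i * (q * q ^ i * q ^ k) = M₂ at *
  generalize 1 - a₂ * q * q ^ i = M₁ at *
  generalize 1 - a₁ * q * q ^ i = N₁ at *
  generalize 1 - a₃ * q * q ^ k = N₄ at *
  generalize 1 - q * q ^ k = N₂ at *
  generalize 1 - q * q ^ i = N₃ at *
  generalize racahNorm q a₂ a₁ _ _ i = R at *
  generalize racahRatio q _ i = G at *
  have e1 : H' = -(H * (N₅ * M₆ * q ^ y)) / (N₂ * (a₁ * a₂ * q ^ 2 * (q ^ i) ^ 2) * N₄ * N₆) := by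
    rw [eq_div_iff (by positivity)]; linear_combination r2
  have e2 : T' = -(a₁ * q * (q ^ i - q * q ^ i * q ^ y) * M₁) * T / N₁ := by
    rw [eq_div_iff n1]; linear_combination r3
  rw [e1, e2, hKe]
  field_simp

set_option maxHeartbeats 1000000 in
lemma edgeCoeff_succ_succ {q a₁ a₂ a₃ : ℝ} (h : Admissible q a₁ a₂ a₃) {n i x z : ℕ}
    (hn : x + z + 1 = n) :
    edgeCoeff q a₁ a₂ a₃ n (i + 1) (x + 1) z =
      edgeCoeff q a₁ a₂ a₃ n i x (z + 1) * (edgeRatio q a₁ a₂ a₃ i (q ^ x) (q ^ n) *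
        (-(a₁ * a₂ * q ^ 2 * q ^ x * (1 - a₃ * q ^ (z + 1)) * (1 - q * q ^ x) * q ^ i) /
          (1 - a₁ * a₂ * q ^ 2 * (q * q ^ i) * q ^ x))) := by
  rcases lt_or_ge x i with hi | hi
  · rw [edgeCoeff_of_lt _ _ _ _ hi, edgeCoeff_of_lt _ _ _ _ (by omega), zero_mul]
  obtain ⟨y, rfl⟩ := Nat.exists_eq_add_of_le hi
  obtain ⟨k, hk⟩ : ∃ k, k = y + z := ⟨_, rfl⟩
  obtain rfl : n = i + 1 + k := by omega
  have hq := h.q_pos.ne'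
  have hc : ∀ l : ℕ, 1 - a₁ * a₂ * q ^ (2 * i + 1) * q ^ (l + 1) ≠ 0 := fun l => by
    have := h.ne₁₂ (2 * i + l)
    rwa [show 2 * i + l + 2 = 2 * i + 1 + (l + 1) by ring, pow_add, ← mul_assoc] at this
  have r1 := racahNorm_succ (a := a₂) (b := a₁) h.q_pos h.q_lt (a₂ * a₃ * q ^ (i + 1 + k + 1))
    (fun k => by rw [mul_comm a₂]; exact h.ne₁₂ k) i k
  have r2 := hahn_self_shift (a := a₁ * a₂ * q ^ (2 * i + 1)) h.q_pos h.pos₃.ne' hc k y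
  have r3 := hahn_top_succ h.q_pos h.q_lt h.pos₂.ne' h.ne₁ i (i + y)
  have r4 := hahn_self_succ h.q_pos h.pos₃.ne' hc (k + 1) y
  rw [edgeCoeff_eq, edgeCoeff_eq, r1, show i + 1 + k - (i + 1) = k by omega,
    show i + 1 + k - i = k + 1 by omega, show i + y + 1 - (i + 1) = y by omega,
    show i + y - i = y by omega, edgeRatio]
  rw [show a₁ * a₂ * q ^ (2 * i + 1) * q ^ 2 = a₁ * a₂ * q ^ (2 * (i + 1) + 1) by ring] at r2
  have n1 : 1 - a₁ * q * q ^ i ≠ 0 := by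
    have := h.ne₁ i; rwa [pow_succ', ← mul_assoc] at this
  have n2 : 1 - q * q ^ k ≠ 0 := by
    have := one_sub_pow_succ_ne_zero h.q_pos h.q_lt k; rwa [pow_succ'] at this
  have n3 : 1 - q * q ^ i ≠ 0 := by
    have := one_sub_pow_succ_ne_zero h.q_pos h.q_lt i; rwa [pow_succ'] at this
  have n4 : 1 - a₃ * q * q ^ k ≠ 0 := by
    have := h.ne₃ k; rwa [pow_succ', ← mul_assoc] at this
  have n5 : 1 - a₁ * a₂ * q ^ 2 * (q ^ i) ^ 2 ≠ 0 := by
    have := h.ne₁₂ (2 * i)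
    rwa [show a₁ * a₂ * q ^ (2 * i + 2) = a₁ * a₂ * q ^ 2 * (q ^ i) ^ 2 by ring] at this
  have n6 : 1 - a₁ * a₂ * q ^ 3 * (q ^ i) ^ 2 * q ^ y ≠ 0 := by
    have := h.ne₁₂ (2 * i + y + 1)
    rwa [show a₁ * a₂ * q ^ (2 * i + y + 1 + 2) =
      a₁ * a₂ * q ^ 3 * (q ^ i) ^ 2 * q ^ y by ring] at this
  have n7 : 1 - a₁ * a₂ * q ^ 2 * (q ^ i) ^ 2 * q ^ y ≠ 0 := by
    have := h.ne₁₂ (2 * i + y)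
    rwa [show a₁ * a₂ * q ^ (2 * i + y + 2) =
      a₁ * a₂ * q ^ 2 * (q ^ i) ^ 2 * q ^ y by ring] at this
  have hI : q ^ i ≠ 0 := pow_ne_zero _ hq
  have hY : q ^ y ≠ 0 := pow_ne_zero _ hq
  have hZ : q ^ z ≠ 0 := pow_ne_zero _ hq
  have hKe : q ^ k = q ^ y * q ^ z := by rw [hk, pow_add]
  rw [show q ^ ((i + 1) * z) = q ^ (i * z) * q ^ z by ring,
    show q ^ (i * (z + 1)) = q ^ (i * z) * q ^ i by ring,
    show q ^ (i + 1 + k) = q * q ^ i * q ^ k by ring, pow_add q i y, pow_succ' q z]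
  rw [show a₁ * (a₂ * a₃ * q ^ (i + 1 + k + 1)) * q * q ^ i =
      a₁ * a₂ * a₃ * q ^ 2 * q ^ i * (q * q ^ i * q ^ k) by ring,
    show a₂ * a₁ = a₁ * a₂ by ring]
  rw [pow_add q i y] at r3
  rw [show (1 - a₁ * a₂ * q ^ (2 * i + 1) * q) * (1 - a₁ * a₂ * q ^ (2 * (i + 1) + 1)) * q ^ y =
    (1 - a₁ * a₂ * q ^ 2 * (q ^ i) ^ 2) * (1 - a₁ * a₂ * q ^ 3 * (q ^ i) ^ 2) * q ^ y by ring,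
    show (1 - q * q ^ k) * (a₁ * a₂ * q ^ (2 * i + 1) * q) * (a₃ * q * q ^ k - 1) *
      (1 - a₁ * a₂ * q ^ (2 * (i + 1) + 1) * q ^ y) =
      -((1 - q * q ^ k) * (a₁ * a₂ * q ^ 2 * (q ^ i) ^ 2) * (1 - a₃ * q * q ^ k) *
      (1 - a₁ * a₂ * q ^ 3 * (q ^ i) ^ 2 * q ^ y)) by ring] at r2
  rw [show 1 - a₁ * a₂ * q ^ (2 * i + 1) * q ^ (y + 1) =
      1 - a₁ * a₂ * q ^ 2 * (q ^ i) ^ 2 * q ^ y by ring,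
    show a₁ * a₂ * q ^ (2 * i + 1) * q * (q ^ y - a₃ * q ^ (k + 1)) =
      a₁ * a₂ * q ^ 2 * (q ^ i) ^ 2 * q ^ y * (1 - a₃ * (q * q ^ z)) by
        rw [pow_succ' q k, hKe]; ring] at r4
  rw [show q ^ i - a₃ * (q * q ^ i * q ^ k) = q ^ i * (1 - a₃ * q * q ^ k) by ring,
    show 1 - a₁ * a₂ * q ^ 2 * q ^ i * (q ^ i * q ^ y) =
      1 - a₁ * a₂ * q ^ 2 * (q ^ i) ^ 2 * q ^ y by ring,
    show 1 - a₁ * a₂ * q ^ 2 * (q * q ^ i) * (q ^ i * q ^ y) =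
      1 - a₁ * a₂ * q ^ 3 * (q ^ i) ^ 2 * q ^ y by ring]
  generalize hahn q (a₁ * a₂ * q ^ (2 * (i + 1) + 1)) a₃ k k y = H' at *
  generalize hahn q (a₁ * a₂ * q ^ (2 * i + 1)) a₃ (k + 1) (k + 1) (y + 1) = H₁ at *
  generalize hahn q (a₁ * a₂ * q ^ (2 * i + 1)) a₃ (k + 1) (k + 1) y = H at *
  generalize hahn q a₁ a₂ i (i + y) (i + y) = T at *
  generalize hahn q a₁ a₂ (i + 1) (i + y + 1) (i + y + 1) = T' at *
  have h1 := h.pos₁.ne'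
  have h2 := h.pos₂.ne'
  generalize 1 - a₁ * a₂ * q ^ 3 * (q ^ i) ^ 2 * q ^ y = N₆ at *
  generalize 1 - a₁ * a₂ * q ^ 2 * (q ^ i) ^ 2 * q ^ y = N₇ at *
  generalize 1 - a₁ * a₂ * q ^ 3 * (q ^ i) ^ 2 = M₆ at *
  generalize 1 - a₁ * a₂ * q ^ 2 * (q ^ i) ^ 2 = N₅ at *
  generalize 1 - a₁ * a₂ * a₃ * q ^ 2 * q ^ i * (q * q ^ i * q ^ k) = M₂ at *
  generalize 1 - a₂ * q * q ^ i = M₁ at *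
  generalize 1 - a₁ * q * q ^ i = N₁ at *
  generalize 1 - a₃ * q * q ^ k = N₄ at *
  generalize 1 - a₃ * (q * q ^ z) = M₄ at *
  generalize 1 - q * q ^ k = N₂ at *
  generalize 1 - q * q ^ i = N₃ at *
  generalize 1 - q * (q ^ i * q ^ y) = M₃ at *
  generalize racahNorm q a₂ a₁ _ _ i = R at *
  generalize racahRatio q _ i = G at *
  have e1 : H' = -(H₁ * (N₅ * M₆ * q ^ y)) / (N₂ * (a₁ * a₂ * q ^ 2 * (q ^ i) ^ 2) * N₄ * N₆) := by
    rw [eq_div_iff (by positivity)]; linear_combination r2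
  have e2 : T' = -(a₁ * q * q ^ i * M₃ * M₁) * T / N₁ := by
    rw [eq_div_iff n1]; linear_combination r3
  have e3 : H₁ = -(a₁ * a₂ * q ^ 2 * (q ^ i) ^ 2 * q ^ y * M₄ * H) / N₇ := by
    rw [eq_div_iff n7]; linear_combination r4
  rw [e1, e2, e3, hKe]
  field_simp

lemma edgeCoeff_zero_succ {q a₁ a₂ a₃ : ℝ} (h : Admissible q a₁ a₂ a₃) (n x z : ℕ) :
    edgeCoeff q a₁ a₂ a₃ n 0 (x + 1) z = edgeCoeff q a₁ a₂ a₃ n 0 x (z + 1) *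
      (-(a₁ * a₂ * q ^ 2 * (q ^ x - a₃ * q ^ n)) / (1 - a₁ * a₂ * q ^ 2 * q ^ x)) := by
  have r := hahn_self_succ (a := a₁ * a₂ * q ^ (2 * 0 + 1)) h.q_pos h.pos₃.ne' (fun l => by
    have := h.ne₁₂ l
    rwa [show a₁ * a₂ * q ^ (l + 2) = a₁ * a₂ * q ^ (2 * 0 + 1) * q ^ (l + 1) by ring] at this) n x
  have n1 : 1 - a₁ * a₂ * q ^ 2 * q ^ x ≠ 0 := by
    have := h.ne₁₂ x
    rwa [show a₁ * a₂ * q ^ (x + 2) = a₁ * a₂ * q ^ 2 * q ^ x by ring] at this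
  rw [edgeCoeff_eq, edgeCoeff_eq, hahn_zero_top h.q_pos h.q_lt, hahn_zero_top h.q_pos h.q_lt]
  simp only [Nat.sub_zero, zero_mul, pow_zero, one_mul, mul_one]
  generalize hahn q (a₁ * a₂ * q ^ (2 * 0 + 1)) a₃ n n (x + 1) = H' at *
  generalize hahn q (a₁ * a₂ * q ^ (2 * 0 + 1)) a₃ n n x = H at *
  rw [mul_div_assoc', eq_div_iff n1]
  linear_combination (racahNorm q a₂ a₁ (a₂ * a₃ * q ^ (n + 1)) n 0) * r

/-- Summation by parts for a sum against solutions of a three-term recurrence. -/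
lemma sum_transfer {x : ℕ} {E E' S A C : ℕ → ℝ} {K₁ K₂ β Z : ℝ} (hE : ∀ i, x < i → E i = 0)
    (hC : C 0 = 0) (h0 : K₁ * E' 0 = K₂ * (E 0 * (β + Z * A 0) - Z * (C 1 * E 1)))
    (hs : ∀ i ≤ x, K₁ * E' (i + 1) = K₂ * (-(Z * (A i * E i)) +
      E (i + 1) * (β + Z * (A (i + 1) + C (i + 1))) - Z * (C (i + 2) * E (i + 2)))) :
    K₁ * ∑ i ∈ Finset.range (x + 2), E' i * S i =
      K₂ * ∑ i ∈ Finset.range (x + 1),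
        E i * (β * S i - Z * (A i * (S (i + 1) - S i) + C i * (S (i - 1) - S i))) := by
  have key : ∀ m ≤ x + 1, K₁ * ∑ i ∈ Finset.range (m + 1), E' i * S i =
      K₂ * (∑ i ∈ Finset.range m,
        E i * (β * S i - Z * (A i * (S (i + 1) - S i) + C i * (S (i - 1) - S i))) +
        (E m * S m * (β + Z * A m + Z * C m) - Z * C m * E m * S (m - 1) -
          Z * C (m + 1) * E (m + 1) * S m)) := by
    intro m hm
    induction m with
    | zero =>
      simp only [zero_add, Finset.sum_range_one, Finset.range_zero, Finset.sum_empty, hC]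
      linear_combination S 0 * h0
    | succ m ih =>
      rw [Finset.sum_range_succ, mul_add, ih (by omega), Finset.sum_range_succ _ m,
        Nat.add_sub_cancel]
      linear_combination S (m + 1) * hs m (by omega)
  have := key (x + 1) le_rfl
  rw [hE (x + 1) (by omega), hE (x + 1 + 1) (by omega)] at this
  rw [this]
  ring

lemma edgeRatio_mul_up {q a₁ a₂ a₃ : ℝ} (h : Admissible q a₁ a₂ a₃) {n i : ℕ} (hi : i < n)
    (x : ℕ) :
    racahUp q a₂ a₁ (a₂ * a₃ * q ^ (n + 1)) (q ^ n)⁻¹ i =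
      edgeRatio q a₁ a₂ a₃ i (q ^ x) (q ^ n) * ((q ^ n - q ^ i) * a₂ * q * (1 - q * q ^ i) *
        (1 - a₁ * (q * q ^ i)) * (q ^ i - a₃ * q ^ n) *
        (1 - a₁ * a₂ * q * (q * q ^ i) * q ^ x) /
        (q ^ n * (1 - a₁ * a₂ * (q * q ^ i) ^ 2) * (1 - a₁ * a₂ * q * (q * q ^ i) ^ 2))) := by
  obtain ⟨k, rfl⟩ := Nat.exists_eq_add_of_lt hi
  have hq := h.q_pos.ne'
  have n1 : 1 - a₁ * q * q ^ i ≠ 0 := by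
    have := h.ne₁ i; rwa [pow_succ', ← mul_assoc] at this
  have n3 : 1 - q * q ^ i ≠ 0 := by
    have := one_sub_pow_succ_ne_zero h.q_pos h.q_lt i; rwa [pow_succ'] at this
  have hI : q ^ i ≠ 0 := pow_ne_zero _ hq
  have n4 : q ^ i - a₃ * q ^ (i + k + 1) ≠ 0 := by
    have := mul_ne_zero hI (h.ne₃ k)
    rwa [show q ^ i * (1 - a₃ * q ^ (k + 1)) = q ^ i - a₃ * q ^ (i + k + 1) by ring] at this
  have n5 : 1 - a₁ * a₂ * q ^ 2 * (q ^ i) ^ 2 ≠ 0 := by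
    have := h.ne₁₂ (2 * i)
    rwa [show a₁ * a₂ * q ^ (2 * i + 2) = a₁ * a₂ * q ^ 2 * (q ^ i) ^ 2 by ring] at this
  have n6 : 1 - a₁ * a₂ * q ^ 3 * (q ^ i) ^ 2 ≠ 0 := by
    have := h.ne₁₂ (2 * i + 1)
    rwa [show a₁ * a₂ * q ^ (2 * i + 1 + 2) =
      a₁ * a₂ * q ^ 3 * (q ^ i) ^ 2 by ring] at this
  have n7 : 1 - a₁ * a₂ * q ^ 2 * q ^ i * q ^ x ≠ 0 := by
    have := h.ne₁₂ (i + x)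
    rwa [show a₁ * a₂ * q ^ (i + x + 2) = a₁ * a₂ * q ^ 2 * q ^ i * q ^ x by ring] at this
  have hW : q ^ (i + k + 1) ≠ 0 := pow_ne_zero _ hq
  have h2 := h.pos₂.ne'
  rw [racahUp, edgeRatio, mul_comm a₂ a₁, pow_succ q (i + k + 1)]
  rw [show 1 - a₁ * a₂ * (q * q ^ i) ^ 2 = 1 - a₁ * a₂ * q ^ 2 * (q ^ i) ^ 2 by ring,
    show 1 - a₁ * a₂ * q * (q * q ^ i) ^ 2 = 1 - a₁ * a₂ * q ^ 3 * (q ^ i) ^ 2 by ring,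
    show 1 - a₁ * a₂ * q * (q * q ^ i) * q ^ x = 1 - a₁ * a₂ * q ^ 2 * q ^ i * q ^ x by ring,
    show 1 - a₁ * (q * q ^ i) = 1 - a₁ * q * q ^ i by ring,
    show a₁ * (a₂ * a₃ * (q ^ (i + k + 1) * q)) * q * q ^ i =
      a₁ * a₂ * a₃ * q ^ 2 * q ^ i * q ^ (i + k + 1) by ring]
  generalize racahRatio q (a₁ * a₂) i = G
  generalize q ^ (i + k + 1) = W at *
  generalize 1 - a₁ * a₂ * a₃ * q ^ 2 * q ^ i * W = M₁
  generalize 1 - a₂ * q * q ^ i = M₂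
  generalize 1 - a₁ * a₂ * q ^ 2 * q ^ i * q ^ x = N₇ at *
  generalize 1 - a₁ * a₂ * q ^ 3 * (q ^ i) ^ 2 = N₆ at *
  generalize 1 - a₁ * a₂ * q ^ 2 * (q ^ i) ^ 2 = N₅ at *
  generalize q ^ i - a₃ * W = N₄ at *
  generalize 1 - q * q ^ i = N₃ at *
  generalize 1 - a₁ * q * q ^ i = N₁ at *
  field_simp

lemma down_mul_edgeCoeff {q a₁ a₂ a₃ : ℝ} (h : Admissible q a₁ a₂ a₃) {n i x z : ℕ}
    (hn : x + z = n) :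
    racahDown q a₂ a₁ (a₂ * a₃ * q ^ (n + 1)) (q ^ n)⁻¹ (i + 1) *
        edgeCoeff q a₁ a₂ a₃ n (i + 1) x z =
      edgeCoeff q a₁ a₂ a₃ n i x z * (-((1 - a₁ * a₂ * q ^ 2 * q ^ i * q ^ n) *
        racahRatio q (a₁ * a₂) i * (1 - a₁ * a₂ * a₃ * q ^ 2 * q ^ i * q ^ n) *
        (q ^ i - q ^ x) * (1 - a₂ * q * q ^ i)) /
        (q ^ n * (1 - a₁ * a₂ * q ^ 2 * (q ^ i) ^ 2) *
          (1 - a₁ * a₂ * q ^ 2 * q ^ i * q ^ x))) := by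
  rw [edgeCoeff_succ_index h hn]
  rcases lt_trichotomy x i with hi | hi | hi
  · rw [edgeCoeff_of_lt _ _ _ _ hi]; simp
  · simp [hi]
  obtain ⟨k, rfl⟩ : ∃ k, n = i + k + 1 := ⟨n - i - 1, by omega⟩
  have hq := h.q_pos.ne'
  have n1 : 1 - a₁ * q * q ^ i ≠ 0 := by
    have := h.ne₁ i; rwa [pow_succ', ← mul_assoc] at this
  have n3 : 1 - q * q ^ i ≠ 0 := by
    have := one_sub_pow_succ_ne_zero h.q_pos h.q_lt i; rwa [pow_succ'] at this
  have hI : q ^ i ≠ 0 := pow_ne_zero _ hq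
  have n4 : q ^ i - a₃ * q ^ (i + k + 1) ≠ 0 := by
    have := mul_ne_zero hI (h.ne₃ k)
    rwa [show q ^ i * (1 - a₃ * q ^ (k + 1)) = q ^ i - a₃ * q ^ (i + k + 1) by ring] at this
  have n5 : 1 - a₁ * a₂ * q ^ 2 * (q ^ i) ^ 2 ≠ 0 := by
    have := h.ne₁₂ (2 * i)
    rwa [show a₁ * a₂ * q ^ (2 * i + 2) = a₁ * a₂ * q ^ 2 * (q ^ i) ^ 2 by ring] at this
  have n6 : 1 - a₁ * a₂ * q ^ 3 * (q ^ i) ^ 2 ≠ 0 := by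
    have := h.ne₁₂ (2 * i + 1)
    rwa [show a₁ * a₂ * q ^ (2 * i + 1 + 2) =
      a₁ * a₂ * q ^ 3 * (q ^ i) ^ 2 by ring] at this
  have n7 : 1 - a₁ * a₂ * q ^ 2 * q ^ i * q ^ x ≠ 0 := by
    have := h.ne₁₂ (i + x)
    rwa [show a₁ * a₂ * q ^ (i + x + 2) = a₁ * a₂ * q ^ 2 * q ^ i * q ^ x by ring] at this
  have hW : q ^ (i + k + 1) ≠ 0 := pow_ne_zero _ hq
  have h2 := h.pos₂.ne'
  rw [racahDown, edgeRatio, mul_comm a₂ a₁, pow_succ q (i + k + 1), pow_succ' q i]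
  have e1 : (q ^ (i + k + 1))⁻¹ - a₁ * a₂ * q * (q * q ^ i) =
      (1 - a₁ * a₂ * q ^ 2 * q ^ i * q ^ (i + k + 1)) / q ^ (i + k + 1) := by
    field_simp
  rw [e1, show 1 - a₁ * a₂ * (q * q ^ i) ^ 2 = 1 - a₁ * a₂ * q ^ 2 * (q ^ i) ^ 2 by ring,
    show 1 - a₁ * a₂ * q * (q * q ^ i) ^ 2 = 1 - a₁ * a₂ * q ^ 3 * (q ^ i) ^ 2 by ring,
    show 1 - a₁ * (q * q ^ i) = 1 - a₁ * q * q ^ i by ring,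
    show a₂ * a₃ * (q ^ (i + k + 1) * q) - a₂ * (q * q ^ i) =
      -(a₂ * q * (q ^ i - a₃ * q ^ (i + k + 1))) by ring]
  generalize racahRatio q (a₁ * a₂) i = G
  generalize edgeCoeff q a₁ a₂ a₃ _ i x z = E
  generalize q ^ (i + k + 1) = W at *
  generalize 1 - a₁ * a₂ * a₃ * q ^ 2 * q ^ i * W = M₁
  generalize 1 - a₁ * a₂ * q ^ 2 * q ^ i * W = M₃
  generalize 1 - a₂ * q * q ^ i = M₂
  generalize 1 - a₁ * a₂ * q ^ 2 * q ^ i * q ^ x = N₇ at *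
  generalize 1 - a₁ * a₂ * q ^ 3 * (q ^ i) ^ 2 = N₆ at *
  generalize 1 - a₁ * a₂ * q ^ 2 * (q ^ i) ^ 2 = N₅ at *
  generalize q ^ i - a₃ * W = N₄ at *
  generalize q ^ i - q ^ x = M₄ at *
  generalize 1 - q * q ^ i = N₃ at *
  generalize 1 - a₁ * q * q ^ i = N₁ at *
  field_simp

set_option maxHeartbeats 2000000 in
lemma edgeCoeff_rec_succ {q a₁ a₂ a₃ : ℝ} (h : Admissible q a₁ a₂ a₃) {n i x z : ℕ}
    (hn : x + z + 1 = n) (hi : i ≤ x) :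
    (1 - a₁ * q * q ^ x) * (1 - q ^ (z + 1)) * edgeCoeff q a₁ a₂ a₃ n (i + 1) (x + 1) z =
      -(a₁ * q * q ^ x) *
        (-(q ^ (z + 1) * (racahUp q a₂ a₁ (a₂ * a₃ * q ^ (n + 1)) (q ^ n)⁻¹ i *
            edgeCoeff q a₁ a₂ a₃ n i x (z + 1))) +
          edgeCoeff q a₁ a₂ a₃ n (i + 1) x (z + 1) *
            ((1 - q ^ (z + 1)) * (1 - a₂ * a₃ * q * q ^ (z + 1)) +
              q ^ (z + 1) * (racahUp q a₂ a₁ (a₂ * a₃ * q ^ (n + 1)) (q ^ n)⁻¹ (i + 1) +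
                racahDown q a₂ a₁ (a₂ * a₃ * q ^ (n + 1)) (q ^ n)⁻¹ (i + 1))) -
          q ^ (z + 1) * (racahDown q a₂ a₁ (a₂ * a₃ * q ^ (n + 1)) (q ^ n)⁻¹ (i + 2) *
            edgeCoeff q a₁ a₂ a₃ n (i + 2) x (z + 1))) := by
  have hn' : x + (z + 1) = n := by omega
  have hq := h.q_pos.ne'
  rw [down_mul_edgeCoeff h hn', edgeCoeff_succ_succ h hn, edgeCoeff_succ_index h hn',
    edgeRatio_mul_up h (show i < n by omega) x]
  have hW : q ^ n = q ^ x * q ^ (z + 1) := by rw [← hn', pow_add]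
  have hJ : q ^ (i + 1) = q * q ^ i := pow_succ' q i
  have n1 : 1 - a₁ * a₂ * (q * q ^ i) ^ 2 ≠ 0 := by
    have := h.ne₁₂ (2 * i)
    rwa [show a₁ * a₂ * q ^ (2 * i + 2) = a₁ * a₂ * (q * q ^ i) ^ 2 by ring] at this
  have n2 : 1 - a₁ * a₂ * q * (q * q ^ i) ^ 2 ≠ 0 := by
    have := h.ne₁₂ (2 * i + 1)
    rwa [show a₁ * a₂ * q ^ (2 * i + 1 + 2) = a₁ * a₂ * q * (q * q ^ i) ^ 2 by ring] at this
  have n3 : 1 - a₁ * a₂ * q ^ 2 * (q * q ^ i) ^ 2 ≠ 0 := by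
    have := h.ne₁₂ (2 * i + 2)
    rwa [show a₁ * a₂ * q ^ (2 * i + 2 + 2) = a₁ * a₂ * q ^ 2 * (q * q ^ i) ^ 2 by ring] at this
  have n4 : 1 - a₁ * a₂ * q ^ 2 * (q * q ^ i) * q ^ x ≠ 0 := by
    have := h.ne₁₂ (i + x + 1)
    rwa [show a₁ * a₂ * q ^ (i + x + 1 + 2) =
      a₁ * a₂ * q ^ 2 * (q * q ^ i) * q ^ x by ring] at this
  have key := coeff_succ (a₃ := a₃) (pow_ne_zero x hq) (pow_ne_zero (z + 1) hq) n1 n2 n3 n4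
  have up : racahUp q a₂ a₁ (a₂ * a₃ * q ^ (n + 1)) (q ^ n)⁻¹ (i + 1) =
      (1 - a₂ * q * (q * q ^ i)) * (1 - a₁ * a₂ * a₃ * q ^ 2 * (q * q ^ i) *
        (q ^ x * q ^ (z + 1))) * (q ^ x * q ^ (z + 1) - q * q ^ i) *
        (1 - a₁ * a₂ * q * (q * q ^ i)) /
        (q ^ x * q ^ (z + 1) * (1 - a₁ * a₂ * q * (q * q ^ i) ^ 2) *
          (1 - a₁ * a₂ * q ^ 2 * (q * q ^ i) ^ 2)) := by
    rw [racahUp, racahRatio, if_neg (Nat.succ_ne_zero i), hJ, pow_succ q n, ← hW, mul_comm a₂ a₁,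
      show 1 - a₁ * (a₂ * a₃ * (q ^ n * q)) * q * (q * q ^ i) =
        1 - a₁ * a₂ * a₃ * q ^ 2 * (q * q ^ i) * q ^ n by ring,
      show 1 - (q ^ n)⁻¹ * (q * q ^ i) = (q ^ n - q * q ^ i) / q ^ n by
        have := pow_ne_zero n hq
        field_simp]
    generalize 1 - a₁ * a₂ * q * (q * q ^ i) ^ 2 = N₂ at *
    generalize 1 - a₁ * a₂ * q ^ 2 * (q * q ^ i) ^ 2 = N₃ at *
    generalize 1 - a₁ * a₂ * q ^ 2 * (q * q ^ i) * q ^ x = N₄ at *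
    generalize 1 - a₁ * a₂ * (q * q ^ i) ^ 2 = N₁ at *
    have hw := pow_ne_zero n hq
    field_simp
  have dn : racahDown q a₂ a₁ (a₂ * a₃ * q ^ (n + 1)) (q ^ n)⁻¹ (i + 1) =
      (1 - q * q ^ i) * (1 - a₁ * (q * q ^ i)) *
        (1 - a₁ * a₂ * q * (q * q ^ i) * (q ^ x * q ^ (z + 1))) *
        (a₂ * (a₃ * q * (q ^ x * q ^ (z + 1)) - q * q ^ i)) /
        (q ^ x * q ^ (z + 1) * (1 - a₁ * a₂ * (q * q ^ i) ^ 2) *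
          (1 - a₁ * a₂ * q * (q * q ^ i) ^ 2)) := by
    rw [racahDown, hJ, pow_succ q n, ← hW, mul_comm a₂ a₁,
      show (q ^ n)⁻¹ - a₁ * a₂ * q * (q * q ^ i) =
          (1 - a₁ * a₂ * q * (q * q ^ i) * q ^ n) / q ^ n by
        have := pow_ne_zero n hq
        field_simp,
      show a₂ * a₃ * (q ^ n * q) - a₂ * (q * q ^ i) = a₂ * (a₃ * q * q ^ n - q * q ^ i) by ring]
    generalize 1 - a₁ * a₂ * q * (q * q ^ i) ^ 2 = N₂ at *
    generalize 1 - a₁ * a₂ * q ^ 2 * (q * q ^ i) ^ 2 = N₃ at *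
    generalize 1 - a₁ * a₂ * q ^ 2 * (q * q ^ i) * q ^ x = N₄ at *
    generalize 1 - a₁ * a₂ * (q * q ^ i) ^ 2 = N₁ at *
    have hw := pow_ne_zero n hq
    field_simp
  have hd : -((1 - a₁ * a₂ * q ^ 2 * q ^ (i + 1) * q ^ n) *
        racahRatio q (a₁ * a₂) (i + 1) * (1 - a₁ * a₂ * a₃ * q ^ 2 * q ^ (i + 1) * q ^ n) *
        (q ^ (i + 1) - q ^ x) * (1 - a₂ * q * q ^ (i + 1))) /
        (q ^ n * (1 - a₁ * a₂ * q ^ 2 * (q ^ (i + 1)) ^ 2) *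
          (1 - a₁ * a₂ * q ^ 2 * q ^ (i + 1) * q ^ x)) =
      -((1 - a₁ * a₂ * q ^ 2 * (q * q ^ i) * (q ^ x * q ^ (z + 1))) *
          (1 - a₁ * a₂ * q * (q * q ^ i)) *
          (1 - a₁ * a₂ * a₃ * q ^ 2 * (q * q ^ i) * (q ^ x * q ^ (z + 1))) * (q * q ^ i - q ^ x) *
          (1 - a₂ * q * (q * q ^ i))) /
        (q ^ x * q ^ (z + 1) * (1 - a₁ * a₂ * q * (q * q ^ i) ^ 2) *
          (1 - a₁ * a₂ * q ^ 2 * (q * q ^ i) ^ 2) *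
          (1 - a₁ * a₂ * q ^ 2 * (q * q ^ i) * q ^ x)) := by
    rw [racahRatio, if_neg (Nat.succ_ne_zero i), hJ, ← hW]
    generalize 1 - a₁ * a₂ * q * (q * q ^ i) ^ 2 = N₂ at *
    generalize 1 - a₁ * a₂ * q ^ 2 * (q * q ^ i) ^ 2 = N₃ at *
    generalize 1 - a₁ * a₂ * q ^ 2 * (q * q ^ i) * q ^ x = N₄ at *
    generalize 1 - a₁ * a₂ * (q * q ^ i) ^ 2 = N₁ at *
    have hw := pow_ne_zero n hq
    field_simp
  rw [up, dn, hd, hW]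
  linear_combination (edgeCoeff q a₁ a₂ a₃ n i x (z + 1) *
    edgeRatio q a₁ a₂ a₃ i (q ^ x) (q ^ x * q ^ (z + 1))) * key

lemma edgeCoeff_rec_zero {q a₁ a₂ a₃ : ℝ} (h : Admissible q a₁ a₂ a₃) {n x z : ℕ}
    (hn : x + z + 1 = n) :
    (1 - a₁ * q * q ^ x) * (1 - q ^ (z + 1)) * edgeCoeff q a₁ a₂ a₃ n 0 (x + 1) z =
      -(a₁ * q * q ^ x) * (edgeCoeff q a₁ a₂ a₃ n 0 x (z + 1) *
          ((1 - q ^ (z + 1)) * (1 - a₂ * a₃ * q * q ^ (z + 1)) +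
            q ^ (z + 1) * racahUp q a₂ a₁ (a₂ * a₃ * q ^ (n + 1)) (q ^ n)⁻¹ 0) -
        q ^ (z + 1) * (racahDown q a₂ a₁ (a₂ * a₃ * q ^ (n + 1)) (q ^ n)⁻¹ 1 *
            edgeCoeff q a₁ a₂ a₃ n 1 x (z + 1))) := by
  have hn' : x + (z + 1) = n := by omega
  have hq := h.q_pos.ne'
  have hd := down_mul_edgeCoeff h (i := 0) hn'
  rw [zero_add] at hd
  rw [hd, edgeCoeff_zero_succ h]
  have hW : q ^ n = q ^ x * q ^ (z + 1) := by rw [← hn', pow_add]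
  have n1 : 1 - a₁ * a₂ * q ^ 2 ≠ 0 := by simpa using h.ne₁₂ 0
  have n2 : 1 - a₁ * a₂ * q ^ 2 * q ^ x ≠ 0 := by
    have := h.ne₁₂ x
    rwa [show a₁ * a₂ * q ^ (x + 2) = a₁ * a₂ * q ^ 2 * q ^ x by ring] at this
  have key := coeff_zero (q := q) (a₁ := a₁) (a₂ := a₂) (a₃ := a₃) (pow_ne_zero x hq)
    (pow_ne_zero (z + 1) hq) rfl rfl n1 n2
  have up : racahUp q a₂ a₁ (a₂ * a₃ * q ^ (n + 1)) (q ^ n)⁻¹ 0 =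
      (1 - a₂ * q) * (1 - a₁ * a₂ * a₃ * q ^ 2 * (q ^ x * q ^ (z + 1))) *
        (q ^ x * q ^ (z + 1) - 1) / (q ^ x * q ^ (z + 1) * (1 - a₁ * a₂ * q ^ 2)) := by
    rw [racahUp, racahRatio, if_pos rfl, pow_succ q n, ← hW, mul_comm a₂ a₁, pow_zero,
      show 1 - a₁ * (a₂ * a₃ * (q ^ n * q)) * q * 1 =
        1 - a₁ * a₂ * a₃ * q ^ 2 * q ^ n by ring,
      show 1 - (q ^ n)⁻¹ * 1 = (q ^ n - 1) / q ^ n by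
        have := pow_ne_zero n hq
        field_simp, one_pow, mul_one, mul_one, mul_one]
    field_simp
  rw [up, racahRatio, if_pos rfl, hW]
  simp only [pow_zero, one_pow, mul_one]
  linear_combination (edgeCoeff q a₁ a₂ a₃ n 0 x (z + 1)) * key

lemma xiAux_edge_succ {q a₁ a₂ a₃ : ℝ} (h : Admissible q a₁ a₂ a₃) {n j x z : ℕ} (hj : j ≤ n)
    (hn : x + z + 1 = n) :
    (1 - a₁ * q * q ^ x) * (1 - q ^ (z + 1)) * xiAux q a₁ a₂ a₃ n j n (x + 1) 0 z =
      -(a₁ * q * q ^ x) * (((1 - q ^ (z + 1)) * (1 - a₂ * a₃ * q * q ^ (z + 1)) +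
        q ^ (z + 1) * ((1 - (q ^ j)⁻¹) * (1 - a₂ * a₃ * q * q ^ j))) *
        xiAux q a₁ a₂ a₃ n j n x 0 (z + 1)) := by
  have hq := h.q_pos.ne'
  have r1 := hahn_self_succ (b := a₂ * a₃ * q ^ (2 * j + 1)) h.q_pos
    (mul_ne_zero (mul_ne_zero h.pos₂.ne' h.pos₃.ne') (pow_ne_zero _ hq)) h.ne₁ (n - j) x
  have r2 := hahn_raise h.q_pos h.q_lt a₂ a₃ j z 0
  have e : q ^ (2 * j + 1) * q ^ (n - j) = q * q ^ j * (q ^ x * q ^ (z + 1)) := by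
    rw [← pow_add, ← pow_add, ← pow_succ', ← pow_add]; congr 1; omega
  have hJ : q ^ j ≠ 0 := pow_ne_zero _ hq
  rw [xiAux, xiAux, zero_add, zero_add]
  generalize hahn q a₂ a₃ j (z + 1) 0 = T at *
  generalize hahn q a₂ a₃ j z 0 = T' at *
  generalize hahn q a₁ (a₂ * a₃ * q ^ (2 * j + 1)) (n - j) (n - j) (x + 1) = H' at *
  generalize hahn q a₁ (a₂ * a₃ * q ^ (2 * j + 1)) (n - j) (n - j) x = H at *
  have e' : (1 - q ^ (z + 1)) * (1 - a₂ * a₃ * q * q ^ (z + 1)) +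
        q ^ (z + 1) * ((1 - (q ^ j)⁻¹) * (1 - a₂ * a₃ * q * q ^ j)) =
      (1 - a₂ * a₃ * q * q ^ j * q ^ (z + 1)) * (q ^ j - q ^ (z + 1)) / q ^ j := by
    field_simp; ring
  rw [e', div_mul_eq_mul_div, mul_div_assoc', eq_div_iff hJ]
  simp only [pow_zero, sub_self, zero_mul, zero_add] at r2
  linear_combination (q ^ j * (1 - q ^ (z + 1)) * T') * r1 +
    a₁ * q * T' * H * q ^ j * (1 - q ^ (z + 1)) * a₂ * a₃ * e + a₁ * q * q ^ x * H *
      (1 - a₂ * a₃ * q * q ^ j * q ^ (z + 1)) * r2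

/-- The connection formula on the edge `x₂ = 0` of the simplex of size `n`. -/
lemma edge_expansion {q a₁ a₂ a₃ : ℝ} (h : Admissible q a₁ a₂ a₃) {n j : ℕ} (hj : j ≤ n) :
    ∀ x z : ℕ, x + z = n → xiAux q a₁ a₂ a₃ n j n x 0 z =
      ∑ i ∈ Finset.range (x + 1), edgeCoeff q a₁ a₂ a₃ n i x z *
        racahSum q a₂ a₁ (a₂ * a₃ * q ^ (n + 1)) (q ^ n)⁻¹ (q ^ j) i := by
  have hq := h.q_pos.ne'
  intro x
  induction x with
  | zero =>
    intro z hz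
    obtain rfl : z = n := by omega
    have r := hahn_at_zero h.q_pos h.q_lt a₂ a₃ j (z - j)
    rw [show j + (z - j) = z by omega] at r
    rw [zero_add, Finset.sum_range_one, edgeCoeff_eq, racahNorm_zero, xiAux, racahSum]
    simp only [Nat.sub_zero, zero_add, Finset.sum_range_one, racahTerm_zero, hahn_self_zero,
      zero_mul, pow_zero, qPoch_zero, one_mul, mul_one, r]
  | succ x ih =>
    intro z hz
    have hK : (1 - a₁ * q * q ^ x) * (1 - q ^ (z + 1)) ≠ 0 := by
      refine mul_ne_zero ?_ (one_sub_pow_succ_ne_zero h.q_pos h.q_lt z)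
      have := h.ne₁ x
      rwa [pow_succ', ← mul_assoc] at this
    apply mul_left_cancel₀ hK
    rw [xiAux_edge_succ h hj (by omega), ih (z + 1) (by omega),
      sum_transfer (E := fun i => edgeCoeff q a₁ a₂ a₃ n i x (z + 1))
        (A := racahUp q a₂ a₁ (a₂ * a₃ * q ^ (n + 1)) (q ^ n)⁻¹)
        (C := racahDown q a₂ a₁ (a₂ * a₃ * q ^ (n + 1)) (q ^ n)⁻¹)
        (K₂ := -(a₁ * q * q ^ x))
        (β := (1 - q ^ (z + 1)) * (1 - a₂ * a₃ * q * q ^ (z + 1))) (Z := q ^ (z + 1))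
        (fun i hi => edgeCoeff_of_lt _ _ _ _ hi _) (by simp [racahDown])
        (edgeCoeff_rec_zero h (by omega)) fun i hi => edgeCoeff_rec_succ h (by omega) hi]
    rw [Finset.mul_sum]
    congr 1
    refine Finset.sum_congr rfl fun i hi => ?_
    rw [Finset.mem_range] at hi
    rw [← racahSum_rec h.q_pos h.q_lt h.ne₂ (fun k => by rw [mul_comm a₂]; exact h.ne₁₂ k)
      (fun k _ => by
        have := h.ne₁₂₃ (n + k - 1)
        rwa [show n + k - 1 + 3 = n + 1 + (k + 1) by omega, pow_add, ← mul_assoc,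
          show a₁ * a₂ * a₃ * q ^ (n + 1) = a₁ * (a₂ * a₃ * q ^ (n + 1)) by ring] at this)
      (fun k hk => by
        have := pow_sub_pow_ne_zero h.q_pos h.q_lt (show k < n by omega)
        intro h0
        apply this
        have hn := pow_ne_zero n hq
        field_simp at h0
        linear_combination -h0) (pow_ne_zero j hq)]
    have e : a₂ * a₃ * q ^ (n + 1) * (q ^ n)⁻¹ = a₂ * a₃ * q := by
      have hn := pow_ne_zero n hq
      rw [pow_succ]; field_simp
    rw [e]
    ring

/-- The connection formula in normalized form. -/
theorem xiAux_eq_sum {q a₁ a₂ a₃ : ℝ} (h : Admissible q a₁ a₂ a₃) {n j N : ℕ} (hj : j ≤ n)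
    (hn : n ≤ N) : ∀ x₁ x₂ x₃ : ℕ, x₁ + x₂ + x₃ = N → xiAux q a₁ a₂ a₃ n j N x₁ x₂ x₃ =
      ∑ i ∈ Finset.range (n + 1), racahNorm q a₂ a₁ (a₂ * a₃ * q ^ (n + 1)) n i *
        racahSum q a₂ a₁ (a₂ * a₃ * q ^ (n + 1)) (q ^ n)⁻¹ (q ^ j) i *
        thetaAux q a₁ a₂ a₃ n i N x₁ x₂ x₃ := by
  generalize hg : (fun i => racahNorm q a₂ a₁ (a₂ * a₃ * q ^ (n + 1)) n i *
        racahSum q a₂ a₁ (a₂ * a₃ * q ^ (n + 1)) (q ^ n)⁻¹ (q ^ j) i) = g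
  have hg' := fun i => congrFun hg i
  simp only [hg']
  induction N, hn using Nat.le_induction with
  | base =>
    intro x₁ x₂
    induction x₂ generalizing x₁ with
    | zero =>
      intro x₃ hx
      rw [edge_expansion h hj x₁ x₃ (by omega)]
      have hs : ∑ i ∈ Finset.range (x₁ + 1), g i * thetaAux q a₁ a₂ a₃ n i n x₁ 0 x₃ =
          ∑ i ∈ Finset.range (n + 1), g i * thetaAux q a₁ a₂ a₃ n i n x₁ 0 x₃ := by
        refine Finset.sum_subset (Finset.range_mono (by omega)) fun i _ hi => ?_
        rw [Finset.mem_range, not_lt] at hi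
        rw [thetaAux, hahn_of_lt (show x₁ + 0 < i by omega)]
        simp
      rw [← hs]
      refine Finset.sum_congr rfl fun i _ => ?_
      rw [edgeCoeff, ← hg' i]
      ring
    | succ x₂ ih =>
      intro x₃ hx
      have c : a₁ * q ^ (x₁ + 1) * (1 - a₂ * q ^ (x₂ + 1)) ≠ 0 :=
        mul_ne_zero (mul_ne_zero h.pos₁.ne' (pow_ne_zero _ h.q_pos.ne')) (h.ne₂ x₂)
      have l1 := xiAux_lower h.q_pos h.q_lt h.ne₁ h.ne₂ h.pos₂.ne' h.pos₃.ne' hj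
        (show x₁ + x₂ + x₃ + 1 = n by omega)
      rw [ih (x₁ + 1) x₃ (by omega), ih x₁ (x₃ + 1) (by omega)] at l1
      apply mul_left_cancel₀ c
      rw [Finset.mul_sum]
      rw [Finset.mul_sum, Finset.mul_sum, add_right_comm, ← Finset.sum_add_distrib] at l1
      rw [eq_neg_of_add_eq_zero_right l1, ← Finset.sum_neg_distrib]
      refine Finset.sum_congr rfl fun i hi => ?_
      rw [Finset.mem_range] at hi
      have l2 := thetaAux_lower h.q_pos h.q_lt h.ne₁ h.ne₁₂ h.pos₂.ne' h.pos₃.ne'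
        (show i ≤ n by omega) (show x₁ + x₂ + x₃ + 1 = n by omega)
      linear_combination -(g i) * l2
  | succ N hN ih =>
    intro x₁ x₂ x₃ hx
    apply mul_left_cancel₀ (pow_sub_pow_ne_zero h.q_pos h.q_lt (show n < N + 1 by omega))
    rw [xiAux_raise h.q_pos h.q_lt _ _ _ hj hN hx]
    have t1 : (1 - q ^ x₁) * xiAux q a₁ a₂ a₃ n j N (x₁ - 1) x₂ x₃ = (1 - q ^ x₁) *
        ∑ i ∈ Finset.range (n + 1), g i * thetaAux q a₁ a₂ a₃ n i N (x₁ - 1) x₂ x₃ := by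
      rcases Nat.eq_zero_or_pos x₁ with rfl | hp
      · simp
      · rw [ih _ _ _ (by omega)]
    have t2 : (1 - q ^ x₂) * xiAux q a₁ a₂ a₃ n j N x₁ (x₂ - 1) x₃ = (1 - q ^ x₂) *
        ∑ i ∈ Finset.range (n + 1), g i * thetaAux q a₁ a₂ a₃ n i N x₁ (x₂ - 1) x₃ := by
      rcases Nat.eq_zero_or_pos x₂ with rfl | hp
      · simp
      · rw [ih _ _ _ (by omega)]
    have t3 : (1 - q ^ x₃) * xiAux q a₁ a₂ a₃ n j N x₁ x₂ (x₃ - 1) = (1 - q ^ x₃) *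
        ∑ i ∈ Finset.range (n + 1), g i * thetaAux q a₁ a₂ a₃ n i N x₁ x₂ (x₃ - 1) := by
      rcases Nat.eq_zero_or_pos x₃ with rfl | hp
      · simp
      · rw [ih _ _ _ (by omega)]
    rw [mul_assoc (q ^ x₁), mul_assoc (q ^ (x₁ + x₂)), t1, t2, t3]
    simp only [Finset.mul_sum, ← Finset.sum_add_distrib]
    refine Finset.sum_congr rfl fun i hi => ?_
    rw [Finset.mem_range] at hi
    have r := thetaAux_raise h.q_pos h.q_lt a₁ a₂ a₃ (show i ≤ n by omega) hN hx
    linear_combination -(g i) * r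

lemma R2Iter_phiH {q : ℝ} (hq0 : 0 < q) (hq1 : q < 1) (a b : ℝ) (n m x : ℕ) :
    R2Iter q n m (phiH q a b n) x = ((q ^ (-((n : ℝ) ^ 2) / 2) * qPoch q q m *
      (q ^ (n * m + m * (m + 1) / 2))⁻¹ * hahnAux q a b n m x : ℝ) : ℂ) := by
  induction m generalizing x with
  | zero =>
    simp only [R2Iter, phiH, hahnAux, qPoch_zero]
    congr 1
    simp
    ring
  | succ m ih =>
    have hq : (q : ℂ) ≠ 0 := Complex.ofReal_ne_zero.2 hq0.ne'
    have hr := hahnAux_succ hq0 hq1 a b n m x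
    have hr' := congrArg (fun t : ℝ => (t : ℂ)) hr
    simp only [R2Iter, R2, ih]
    have e1 : (q : ℂ) ^ (-((n + m : ℕ) : ℤ) - 1) = (((q ^ (n + m + 1))⁻¹ : ℝ) : ℂ) := by
      rw [show -((n + m : ℕ) : ℤ) - 1 = -((n + m + 1 : ℕ) : ℤ) by push_cast; ring,
        zpow_neg, zpow_natCast]
      push_cast
      rfl
    have e2 : (q : ℂ) ^ ((x : ℤ) - (n + m : ℕ) - 1) *
        (1 - (q : ℂ) ^ (((n + m : ℕ) : ℤ) + 1 - x)) =
        (((q ^ (n + m + 1))⁻¹ * (q ^ x - q ^ (n + m + 1)) : ℝ) : ℂ) := by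
      rw [mul_sub, ← zpow_add₀ hq, mul_one,
        show (x : ℤ) - (n + m : ℕ) - 1 = -((n + m + 1 : ℕ) : ℤ) + (x : ℕ) by push_cast; ring,
        zpow_add₀ hq, zpow_neg, zpow_natCast, zpow_natCast,
        show -((n + m + 1 : ℕ) : ℤ) + (x : ℕ) + (((n + m : ℕ) : ℤ) + 1 - x) = 0 by push_cast; ring,
        zpow_zero]
      have := pow_ne_zero (n + m + 1) hq
      push_cast
      field_simp
    have e3 : n * (m + 1) + (m + 1) * (m + 1 + 1) / 2 =
        n * m + m * (m + 1) / 2 + (n + m + 1) := by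
      have : (m + 1) * (m + 1 + 1) = m * (m + 1) + 2 * (m + 1) := by ring
      rw [this, Nat.add_mul_div_left _ _ (by norm_num)]
      ring
    rw [e1, e2, e3, pow_add q (n * m + m * (m + 1) / 2), mul_inv, qPoch_succ]
    generalize q ^ (-((n : ℝ) ^ 2) / 2) = κ
    generalize hahnAux q a b n m (x - 1) = H₀ at *
    generalize hahnAux q a b n m x = H at *
    generalize hahnAux q a b n (m + 1) x = H' at *
    push_cast at hr' ⊢
    linear_combination -((κ : ℂ) * (qPoch q q m : ℂ) * ((q : ℂ) ^ (n * m + m * (m + 1) / 2))⁻¹ *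
      ((q : ℂ) ^ (n + m + 1))⁻¹) * hr'

lemma qHahnQ_eq {q : ℝ} (hq0 : 0 < q) (hq1 : q < 1) (a b : ℝ) {n N : ℕ} (h : n ≤ N) (x : ℕ) :
    qHahnQ q a b n N x = ((q ^ (-((n : ℝ) ^ 2) / 2) * (q ^ (n * (N - n)))⁻¹ *
      hahn q a b n N x : ℝ) : ℂ) := by
  obtain ⟨m, rfl⟩ := Nat.exists_eq_add_of_le h
  rw [qHahnQ, R2Iter_phiH hq0 hq1, hahn, if_pos h, Nat.add_sub_cancel_left, pow_add]
  have h1 : (q : ℂ) ≠ 0 := Complex.ofReal_ne_zero.2 hq0.ne'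
  have h2 : (qPoch q q m : ℂ) ≠ 0 := Complex.ofReal_ne_zero.2 (qPoch_self_ne_zero hq0 hq1 m)
  push_cast
  field_simp

lemma gauss_mul_gauss {q : ℝ} (hq0 : 0 < q) {i n : ℕ} (h : i ≤ n) :
    q ^ (-(((n - i : ℕ) : ℝ) ^ 2) / 2) * q ^ (-((i : ℝ) ^ 2) / 2) =
      q ^ (-((n : ℝ) ^ 2) / 2) * q ^ (i * (n - i)) := by
  rw [← Real.rpow_natCast q (i * (n - i)), ← Real.rpow_add hq0, ← Real.rpow_add hq0]
  congr 1
  push_cast [Nat.cast_sub h]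
  ring

lemma qRacah_eq (q a b d : ℝ) (hq0 : 0 < q) (n i j : ℕ) :
    qRacah q a b d n i j = racahNorm q a b d n i * racahSum q a b d (q ^ n)⁻¹ (q ^ j) i := by
  rw [qRacah, racahNorm, racahSum]
  congr 1
  refine Finset.sum_congr rfl fun k _ => ?_
  rw [racahTerm, sub_eq_neg_add, zpow_add₀ hq0.ne', zpow_neg, zpow_neg, zpow_neg, zpow_natCast,
    zpow_natCast, zpow_natCast, mul_assoc d]
  ring

lemma xi_eq {q a₁ a₂ a₃ : ℝ} (hq0 : 0 < q) (hq1 : q < 1) {n j N x₁ x₂ x₃ : ℕ} (hj : j ≤ n)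
    (hn : n ≤ N) (hx : x₁ + x₂ + x₃ = N) :
    (if j ≤ x₂ + x₃ then
        (q : ℂ) ^ (-((j * x₁ : ℕ) : ℤ)) *
          qHahnQ q a₁ (a₂ * a₃ * q ^ (2 * j + 1)) (n - j) (N - j) x₁ *
          qHahnQ q a₂ a₃ j (x₂ + x₃) x₂
      else 0) = ((q ^ (-((n : ℝ) ^ 2) / 2) * (q ^ (n * (N - n)))⁻¹ *
        xiAux q a₁ a₂ a₃ n j N x₁ x₂ x₃ : ℝ) : ℂ) := by
  rw [xiAux]
  split_ifs with h
  · rw [qHahnQ_eq hq0 hq1 _ _ (show n - j ≤ N - j by omega), qHahnQ_eq hq0 hq1 _ _ h, zpow_neg,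
      zpow_natCast]
    generalize hahn q a₁ (a₂ * a₃ * q ^ (2 * j + 1)) (n - j) (N - j) x₁ = H
    generalize hahn q a₂ a₃ j (x₂ + x₃) x₂ = H'
    have g := gauss_mul_gauss hq0 hj
    have e : q ^ (j * x₁) * q ^ ((n - j) * (N - j - (n - j))) * q ^ (j * (x₂ + x₃ - j)) =
        q ^ (j * (n - j)) * q ^ (n * (N - n)) := by
      obtain ⟨m, rfl⟩ := Nat.exists_eq_add_of_le hn
      obtain ⟨k, rfl⟩ := Nat.exists_eq_add_of_le hj
      obtain ⟨t, ht⟩ := Nat.exists_eq_add_of_le h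
      rw [ht, show j + k + m - j - (j + k - j) = m by omega, show j + k + m - (j + k) = m by omega,
        Nat.add_sub_cancel_left, Nat.add_sub_cancel_left, ← pow_add, ← pow_add, ← pow_add]
      congr 1
      have : x₁ + t = k + m := by omega
      linear_combination j * this
    rw [← Complex.ofReal_pow, ← Complex.ofReal_inv, ← Complex.ofReal_mul, ← Complex.ofReal_mul,
      Complex.ofReal_inj]
    have p1 := pow_ne_zero (j * x₁) hq0.ne'
    have p2 := pow_ne_zero ((n - j) * (N - j - (n - j))) hq0.ne'
    have p3 := pow_ne_zero (j * (x₂ + x₃ - j)) hq0.ne'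
    have p4 := pow_ne_zero (n * (N - n)) hq0.ne'
    generalize q ^ (j * x₁) = P₁ at *
    generalize q ^ ((n - j) * (N - j - (n - j))) = P₂ at *
    generalize q ^ (j * (x₂ + x₃ - j)) = P₃ at *
    generalize q ^ (n * (N - n)) = P₄ at *
    generalize q ^ (-(((n - j : ℕ) : ℝ) ^ 2) / 2) = κ₁ at *
    generalize q ^ (-((j : ℝ) ^ 2) / 2) = κ₂ at *
    generalize q ^ (-((n : ℝ) ^ 2) / 2) = κ at *
    field_simp
    linear_combination H * H' * P₄ * g - κ * H * H' * e
  · rw [hahn_of_lt (not_le.1 h)]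
    simp

lemma theta_eq {q a₁ a₂ a₃ : ℝ} (hq0 : 0 < q) (hq1 : q < 1) {n i N x₁ x₂ x₃ : ℕ} (hi : i ≤ n)
    (hn : n ≤ N) (hx : x₁ + x₂ + x₃ = N) :
    (if i ≤ x₁ + x₂ then
        qHahnQ q (a₁ * a₂ * q ^ (2 * i + 1)) a₃ (n - i) (N - i) (x₁ + x₂ - i) *
            qHahnQ q a₁ a₂ i (x₁ + x₂) x₁
      else 0) = ((q ^ (-((n : ℝ) ^ 2) / 2) * (q ^ (n * (N - n)))⁻¹ *
        thetaAux q a₁ a₂ a₃ n i N x₁ x₂ x₃ : ℝ) : ℂ) := by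
  rw [thetaAux]
  split_ifs with h
  · rw [qHahnQ_eq hq0 hq1 _ _ (show n - i ≤ N - i by omega), qHahnQ_eq hq0 hq1 _ _ h]
    generalize hahn q (a₁ * a₂ * q ^ (2 * i + 1)) a₃ (n - i) (N - i) (x₁ + x₂ - i) = H
    generalize hahn q a₁ a₂ i (x₁ + x₂) x₁ = H'
    have g := gauss_mul_gauss hq0 hi
    have e : q ^ (i * x₃) * q ^ ((n - i) * (N - i - (n - i))) * q ^ (i * (x₁ + x₂ - i)) =
        q ^ (i * (n - i)) * q ^ (n * (N - n)) := by
      obtain ⟨m, rfl⟩ := Nat.exists_eq_add_of_le hn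
      obtain ⟨k, rfl⟩ := Nat.exists_eq_add_of_le hi
      obtain ⟨t, ht⟩ := Nat.exists_eq_add_of_le h
      rw [ht, show i + k + m - i - (i + k - i) = m by omega, show i + k + m - (i + k) = m by omega,
        Nat.add_sub_cancel_left, Nat.add_sub_cancel_left, ← pow_add, ← pow_add, ← pow_add]
      congr 1
      have : x₃ + t = k + m := by omega
      linear_combination i * this
    rw [← Complex.ofReal_mul, Complex.ofReal_inj]
    have p2 := pow_ne_zero ((n - i) * (N - i - (n - i))) hq0.ne'
    have p3 := pow_ne_zero (i * (x₁ + x₂ - i)) hq0.ne'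
    have p4 := pow_ne_zero (n * (N - n)) hq0.ne'
    generalize q ^ (i * x₃) = P₁ at *
    generalize q ^ ((n - i) * (N - i - (n - i))) = P₂ at *
    generalize q ^ (i * (x₁ + x₂ - i)) = P₃ at *
    generalize q ^ (n * (N - n)) = P₄ at *
    generalize q ^ (-(((n - i : ℕ) : ℝ) ^ 2) / 2) = κ₁ at *
    generalize q ^ (-((i : ℝ) ^ 2) / 2) = κ₂ at *
    generalize q ^ (-((n : ℝ) ^ 2) / 2) = κ at *
    field_simp
    linear_combination H * H' * P₄ * g - κ * H * H' * e
  · rw [hahn_of_lt (not_le.1 h)]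
    simp

theorem stmt19 (q : ℝ) (hq0 : 0 < q) (hq1 : q < 1)
    (α₁ α₂ α₃ : ℝ) (h₁ : 0 < α₁) (h₂ : 0 < α₂) (h₃ : 0 < α₃)
    (h₁' : α₁ < q⁻¹) (h₂' : α₂ < q⁻¹) (h₃' : α₃ < q⁻¹)
    (n N : ℕ) (hnN : n ≤ N) :
    ∀ j ≤ n, ∀ x₁ x₂ x₃ : ℕ, x₁ + x₂ + x₃ = N →
      (if j ≤ x₂ + x₃ then
        (q : ℂ) ^ (-((j * x₁ : ℕ) : ℤ)) *
          qHahnQ q α₁ (α₂ * α₃ * q ^ (2 * j + 1)) (n - j) (N - j) x₁ *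
          qHahnQ q α₂ α₃ j (x₂ + x₃) x₂
      else 0) =
      ∑ i ∈ Finset.range (n + 1),
        ((qRacah q α₂ α₁ (α₂ * α₃ * q ^ (n + 1)) n i j : ℝ) : ℂ) *
        (if i ≤ x₁ + x₂ then
          qHahnQ q (α₁ * α₂ * q ^ (2 * i + 1)) α₃ (n - i) (N - i) (x₁ + x₂ - i) *
            qHahnQ q α₁ α₂ i (x₁ + x₂) x₁
        else 0) := by
  have lt_one : ∀ a : ℝ, a < q⁻¹ → a * q < 1 := fun a ha => by
    simpa [hq0.ne'] using mul_lt_mul_of_pos_right ha hq0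
  have h : Admissible q α₁ α₂ α₃ :=
    ⟨hq0, hq1, h₁, h₂, h₃, lt_one _ h₁', lt_one _ h₂', lt_one _ h₃'⟩
  intro j hj x₁ x₂ x₃ hx
  rw [xi_eq hq0 hq1 hj hnN hx, xiAux_eq_sum h hj hnN x₁ x₂ x₃ hx, Finset.mul_sum,
    Complex.ofReal_sum]
  refine Finset.sum_congr rfl fun i hi => ?_
  rw [Finset.mem_range] at hi
  rw [theta_eq (x₃ := x₃) hq0 hq1 (show i ≤ n by omega) hnN hx, qRacah_eq _ _ _ _ hq0]
  push_cast
  ring
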